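/- arXiv:2311.12697 — 2 statements merged into one kernel-verified Lean document; each statement's English description precedes it below -/
import Mathlib

section
/- Let M be a generator-cogenerator of mod-Λ and X a Λ-module with M-dimension r < ∞. Then gldim End_Λ(M) ≤ gldim End_Λ(M ⊕ X) + r. -/
open CategoryTheory CategoryTheory.Limits Opposite

universe u

namespace Rigidity

variable (Λ : Type u) [Ring Λ]

/-- `X` belongs to `add M`: it is a direct summand of a finite direct sum of copies of `M`. -/
def InAdd (M X : ModuleCat.{u} Λ) : Prop :=
  ∃ (r : ℕ) (Y : ModuleCat.{u} Λ), Nonempty ((X ⊞ Y) ≅ ⨁ (fun _ : Fin r => M))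

/-- An indecomposable object. -/
def Indec (X : ModuleCat.{u} Λ) : Prop :=
  ¬ IsZero X ∧ ∀ A B : ModuleCat.{u} Λ, Nonempty (X ≅ A ⊞ B) → IsZero A ∨ IsZero B

/-- A generator-cogenerator: `add M` contains the regular module and all
finitely generated injective modules. -/
def IsGenCogen (M : ModuleCat.{u} Λ) : Prop :=
  InAdd Λ M (ModuleCat.of Λ Λ) ∧
  ∀ I : ModuleCat.{u} Λ, Module.Finite Λ I → Injective I → InAdd Λ M I

/-- `g : A ⟶ X` is a right minimal `add M`-approximation. -/
def IsRMApprox (M : ModuleCat.{u} Λ) {A X : ModuleCat.{u} Λ} (g : A ⟶ X) : Prop :=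
  InAdd Λ M A ∧
  (∀ T : ModuleCat.{u} Λ, InAdd Λ M T → ∀ f : T ⟶ X, ∃ h : T ⟶ A, h ≫ g = f) ∧
  (∀ h : A ⟶ A, h ≫ g = g → IsIso h)

/-- `IsMSyzygy M X r W` : `W` is an `r`-th `M`-syzygy `Ω_M^r(X)` of `X`. -/
inductive IsMSyzygy (M : ModuleCat.{u} Λ) : ModuleCat.{u} Λ → ℕ → ModuleCat.{u} Λ → Prop
  | zero (X : ModuleCat.{u} Λ) : IsMSyzygy M X 0 X
  | succ (X : ModuleCat.{u} Λ) (r : ℕ) (W A : ModuleCat.{u} Λ) (g : A ⟶ W)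
      (hW : IsMSyzygy M X r W) (hg : IsRMApprox Λ M g) :
      IsMSyzygy M X (r + 1) (kernel g)

/-- The `M`-dimension of `X` is at most `r`. -/
def MdimLE (M X : ModuleCat.{u} Λ) (r : ℕ) : Prop :=
  ∃ W : ModuleCat.{u} Λ, IsMSyzygy Λ M X r W ∧ InAdd Λ M W

/-- projective dimension at most `r`, via a length `r` projective resolution. -/
def ProjDimLE (A : Type u) [Ring A] (N : ModuleCat.{u} A) (r : ℕ) : Prop :=
  ∃ (P : ℕ → ModuleCat.{u} A) (d : ∀ i : ℕ, P (i + 1) ⟶ P i) (f : P 0 ⟶ N),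
    (∀ i, Projective (P i)) ∧ (∀ i, r < i → IsZero (P i)) ∧ Epi f ∧
    (∃ w : d 0 ≫ f = 0, (ShortComplex.mk (d 0) f w).Exact) ∧
    (∀ i, ∃ w : d (i + 1) ≫ d i = 0, (ShortComplex.mk (d (i + 1)) (d i) w).Exact)

/-- global dimension at most `r`. -/
def GldimLE (A : Type u) [Ring A] (r : ℕ) : Prop :=
  ∀ N : ModuleCat.{u} A, ProjDimLE A N r

/-- the global dimension, as an element of `ℕ∞`. -/
noncomputable def gldim (A : Type u) [Ring A] : ℕ∞ :=
  sInf {c : ℕ∞ | ∃ r : ℕ, c = (r : ℕ∞) ∧ GldimLE A r}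

/-- dominant dimension at least `r`: there is an exact sequence
`0 → A → I^0 → ⋯ → I^(r-1)` with all `I^i` projective-injective. -/
def DomdimGE (A : Type u) [Ring A] (r : ℕ) : Prop :=
  ∃ (I : ℕ → ModuleCat.{u} A) (f : ModuleCat.of A A ⟶ I 0) (g : ∀ i : ℕ, I i ⟶ I (i + 1)),
    Mono f ∧ (∀ i, i < r → Injective (I i) ∧ Projective (I i)) ∧
    (2 ≤ r → ∃ w : f ≫ g 0 = 0, (ShortComplex.mk f (g 0) w).Exact) ∧
    (∀ i, i + 3 ≤ r → ∃ w : g i ≫ g (i + 1) = 0, (ShortComplex.mk (g i) (g (i + 1)) w).Exact)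

/-- the dominant dimension, as an element of `ℕ∞`. -/
noncomputable def domdim (A : Type u) [Ring A] : ℕ∞ :=
  sSup {c : ℕ∞ | ∃ r : ℕ, c = (r : ℕ∞) ∧ DomdimGE A r}

/-- the rigidity degree of a module, as an element of `ℕ∞`. -/
noncomputable def rigDeg [HasExt.{u} (ModuleCat.{u} Λ)] (M : ModuleCat.{u} Λ) : ℕ∞ :=
  sSup {c : ℕ∞ | ∃ r : ℕ, c = (r : ℕ∞) ∧ 0 < r ∧
    ∀ i : ℕ, 1 ≤ i → i ≤ r → Subsingleton (Abelian.Ext M M i)}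

/-- the rigidity dimension. -/
noncomputable def rigdim : ℕ∞ :=
  sSup {c : ℕ∞ | ∃ M : ModuleCat.{u} Λ, Module.Finite Λ M ∧ IsGenCogen Λ M ∧
    (∃ r : ℕ, GldimLE (End (op M)) r) ∧ c = domdim (End (op M))}

/-- An Auslander-Reiten (almost split) sequence. -/
def IsARSeq {X Y Z : ModuleCat.{u} Λ} (f : X ⟶ Y) (g : Y ⟶ Z) : Prop :=
  Mono f ∧ Epi g ∧ (∃ w : f ≫ g = 0, (ShortComplex.mk f g w).Exact) ∧
  Indec Λ X ∧ Indec Λ Z ∧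
  (¬ ∃ s : Z ⟶ Y, s ≫ g = 𝟙 Z) ∧
  (∀ (W : ModuleCat.{u} Λ) (h : W ⟶ Z), (¬ ∃ s : Z ⟶ W, s ≫ h = 𝟙 Z) →
    ∃ h' : W ⟶ Y, h' ≫ g = h)

/-- `X` has composition length `t`. -/
def HasCompLength (X : ModuleCat.{u} Λ) (t : ℕ) : Prop :=
  (∃ c : Fin (t + 1) → Submodule Λ X, StrictMono c ∧ c 0 = ⊥ ∧ c (Fin.last t) = ⊤) ∧
  ∀ r : ℕ, (∃ c : Fin (r + 1) → Submodule Λ X, StrictMono c ∧ c 0 = ⊥ ∧ c (Fin.last r) = ⊤) →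
    r ≤ t

section ProjectiveDimension

variable {R : Type u} [Ring R]

lemma hasProjectiveDimensionLT_right_of_exact {A B C : Type u} [AddCommGroup A] [AddCommGroup B]
    [AddCommGroup C] [Module R A] [Module R B] [Module R C] (f : A →ₗ[R] B) (g : B →ₗ[R] C)
    (hf : Function.Injective f) (hg : Function.Surjective g) (hfg : Function.Exact f g) (n : ℕ)
    (hA : HasProjectiveDimensionLT (ModuleCat.of R A) n)
    (hB : HasProjectiveDimensionLT (ModuleCat.of R B) (n + 1)) :
    HasProjectiveDimensionLT (ModuleCat.of R C) (n + 1) :=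
  (ModuleCat.shortComplex_shortExact
    (ModuleCat.shortComplexOfCompEqZero f g hfg.linearMap_comp_eq_zero) hfg hf
    hg).hasProjectiveDimensionLT_X₃ n hA hB

lemma hasProjectiveDimensionLT_of_leftInverse {A B : Type u} [AddCommGroup A] [AddCommGroup B]
    [Module R A] [Module R B] (i : A →ₗ[R] B) (p : B →ₗ[R] A) (h : Function.LeftInverse p i)
    (n : ℕ) (hB : HasProjectiveDimensionLT (ModuleCat.of R B) n) :
    HasProjectiveDimensionLT (ModuleCat.of R A) n :=
  Retract.hasProjectiveDimensionLT (Y := ModuleCat.of R B)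
    { i := ModuleCat.ofHom i
      r := ModuleCat.ofHom p
      retract := by ext x; exact h x } n

lemma hasProjectiveDimensionLT_one_iff (A : Type u) [AddCommGroup A] [Module R A] :
    HasProjectiveDimensionLT (ModuleCat.of R A) 1 ↔ Module.Projective R A := by
  rw [← projective_iff_hasProjectiveDimensionLT_one, ← IsProjective.iff_projective]

lemma hasProjectiveDimensionLT_ker_of_surjective {B C : Type u} [AddCommGroup B]
    [AddCommGroup C] [Module R B] [Module R C] [Module.Projective R B] (g : B →ₗ[R] C)
    (hg : Function.Surjective g) (n : ℕ)
    (hC : HasProjectiveDimensionLT (ModuleCat.of R C) (n + 2)) :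
    HasProjectiveDimensionLT (ModuleCat.of R (LinearMap.ker g)) (n + 1) :=
  ((LinearMap.shortExact_shortComplexKer hg).hasProjectiveDimensionLT_X₃_iff n
    ((IsProjective.iff_projective B).1 ‹_›)).1 hC

lemma hasProjectiveDimensionLT_finsupp (I : Type u) (n : ℕ) (A : Type u) [AddCommGroup A]
    [Module R A] (hA : HasProjectiveDimensionLT (ModuleCat.of R A) (n + 1)) :
    HasProjectiveDimensionLT (ModuleCat.of R (I →₀ A)) (n + 1) := by
  induction n generalizing A with
  | zero =>
    classical
    rw [zero_add, hasProjectiveDimensionLT_one_iff] at hA ⊢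
    exact Module.Projective.of_equiv (finsuppLequivDFinsupp R).symm
  | succ n ih =>
    have hg := Finsupp.linearCombination_id_surjective R A
    set g := Finsupp.linearCombination R (id : A → A)
    refine hasProjectiveDimensionLT_right_of_exact (B := I →₀ A →₀ R)
      (Finsupp.mapRange.linearMap (α := I) (LinearMap.ker g).subtype)
      (Finsupp.mapRange.linearMap (α := I) g) ?_ ?_ ?_ (n + 1)
      (ih _ (hasProjectiveDimensionLT_ker_of_surjective g hg n hA)) ?_
    · exact Finsupp.mapRange_injective _ (map_zero _) (LinearMap.ker g).injective_subtype
    · exact Finsupp.mapRange_surjective _ (map_zero _) hg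
    · rw [LinearMap.exact_iff, Finsupp.ker_mapRange, Finsupp.range_mapRange_linearMap _ (by simp),
        Submodule.range_subtype]
    · have : HasProjectiveDimensionLT (ModuleCat.of R (I →₀ A →₀ R)) 1 :=
        (hasProjectiveDimensionLT_one_iff _).2 inferInstance
      exact hasProjectiveDimensionLT_of_ge _ 1 _ (by lia)

lemma ProjDimLE.hasProjectiveDimensionLT {N : ModuleCat.{u} R} {n : ℕ} (h : ProjDimLE R N n) :
    HasProjectiveDimensionLT N (n + 1) := by
  induction n generalizing N with
  | zero =>
    obtain ⟨P, d, f, hP, hz, hf, ⟨w, hex⟩, -⟩ := h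
    have : Mono f := hex.mono_g ((hz 1 (by lia)).eq_of_src _ _)
    have : IsIso f := isIso_of_mono_of_epi f
    have := hP 0
    exact hasProjectiveDimensionLT_of_iso (asIso f) 1
  | succ n ih =>
    obtain ⟨P, d, f, hP, hz, hf, ⟨w, hex⟩, hd⟩ := h
    have hK : ProjDimLE R (kernel f) n := by
      refine ⟨fun i => P (i + 1), fun i => d (i + 1), kernel.lift f (d 0) w, fun i => hP _,
        fun i hi => hz _ (by lia), ?_, ?_, fun i => hd (i + 1)⟩
      · exact (ShortComplex.exact_iff_epi_kernel_lift _).1 hex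
      · obtain ⟨w', h'⟩ := hd 0
        have w'' : d 1 ≫ kernel.lift f (d 0) w = 0 := by
          rw [← cancel_mono (kernel.ι f)]; simpa using w'
        refine ⟨w'', ?_⟩
        let φ : ShortComplex.mk (d 1) (kernel.lift f (d 0) w) w'' ⟶
            ShortComplex.mk (d 1) (d 0) w' :=
          { τ₁ := 𝟙 _, τ₂ := 𝟙 _, τ₃ := kernel.ι f }
        have : Epi φ.τ₁ := inferInstanceAs (Epi (𝟙 _))
        have : IsIso φ.τ₂ := inferInstanceAs (IsIso (𝟙 _))
        have : Mono φ.τ₃ := inferInstanceAs (Mono (kernel.ι f))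
        exact (ShortComplex.exact_iff_of_epi_of_isIso_of_mono φ).2 h'
    have hS : (ShortComplex.mk (kernel.ι f) f (kernel.condition f)).ShortExact :=
      { exact := ShortComplex.exact_kernel f }
    have := hP 0
    exact (hS.hasProjectiveDimensionLT_X₃_iff n (hP 0)).2 (ih hK)

open scoped ZeroObject in
lemma projDimLE_of_hasProjectiveDimensionLT {N : ModuleCat.{u} R} {n : ℕ}
    (h : HasProjectiveDimensionLT N (n + 1)) : ProjDimLE R N n := by
  induction n generalizing N with
  | zero =>
    have hN : Projective N := projective_iff_hasProjectiveDimensionLT_one.2 h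
    refine ⟨fun i => Nat.casesOn i N (fun _ => 0), fun i => 0, 𝟙 N, ?_, ?_, inferInstance,
      ⟨by simp, ?_⟩, fun i => ⟨by simp, ?_⟩⟩
    · rintro (_ | i)
      · exact hN
      · exact (inferInstance : Projective (0 : ModuleCat.{u} R))
    · rintro (_ | i) hi
      · lia
      · exact isZero_zero _
    · rw [ShortComplex.exact_iff_mono _ rfl]
      exact (inferInstance : Mono (𝟙 N))
    · exact ShortComplex.exact_of_isZero_X₂ _ (isZero_zero _)
  | succ n ih =>
    let f := Projective.π N
    have hS : (ShortComplex.mk (kernel.ι f) f (kernel.condition f)).ShortExact :=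
      { exact := ShortComplex.exact_kernel f }
    obtain ⟨P, d, g, hP, hz, hg, ⟨w, hex⟩, hd⟩ :=
      ih ((hS.hasProjectiveDimensionLT_X₃_iff n (Projective.projective_over N)).1 h)
    refine ⟨fun i => Nat.casesOn i (Projective.over N) P,
      fun i => Nat.casesOn i (g ≫ kernel.ι f) d, f, ?_, ?_, (inferInstance : Epi f), ?_, ?_⟩
    · rintro (_ | i)
      · exact Projective.projective_over N
      · exact hP i
    · rintro (_ | i) hi
      · lia
      · exact hz i (by lia)
    · have w' : (g ≫ kernel.ι f) ≫ f = 0 := by simp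
      refine ⟨w', ?_⟩
      let φ : ShortComplex.mk (g ≫ kernel.ι f) f w' ⟶
          ShortComplex.mk (kernel.ι f) f (kernel.condition f) :=
        { τ₁ := g, τ₂ := 𝟙 _, τ₃ := 𝟙 _ }
      have : Epi φ.τ₁ := hg
      have : IsIso φ.τ₂ := inferInstanceAs (IsIso (𝟙 _))
      have : Mono φ.τ₃ := inferInstanceAs (Mono (𝟙 _))
      exact (ShortComplex.exact_iff_of_epi_of_isIso_of_mono φ).2 hS.exact
    · rintro (_ | i)
      · have w' : d 0 ≫ g ≫ kernel.ι f = 0 := by rw [reassoc_of% w, zero_comp]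
        refine ⟨w', ?_⟩
        let φ : ShortComplex.mk (d 0) g w ⟶ ShortComplex.mk (d 0) (g ≫ kernel.ι f) w' :=
          { τ₁ := 𝟙 _, τ₂ := 𝟙 _, τ₃ := kernel.ι f }
        have : Epi φ.τ₁ := inferInstanceAs (Epi (𝟙 _))
        have : IsIso φ.τ₂ := inferInstanceAs (IsIso (𝟙 _))
        have : Mono φ.τ₃ := inferInstanceAs (Mono (kernel.ι f))
        exact (ShortComplex.exact_iff_of_epi_of_isIso_of_mono φ).1 hex
      · exact hd i

end ProjectiveDimension

section Corner

variable {R S : Type u} [Ring R] [Ring S] (φ : R →ₙ+* S)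

/-- The elements of an `S`-module fixed by the idempotent `φ 1`. -/
def corner (N : Type u) [AddCommGroup N] [Module S N] : AddSubgroup N where
  carrier := {x | φ 1 • x = x}
  add_mem' {x y} hx hy := by
    change φ 1 • (x + y) = x + y
    rw [smul_add, hx, hy]
  zero_mem' := smul_zero _
  neg_mem' {x} hx := by
    change φ 1 • (-x) = -x
    rw [smul_neg, hx]

variable {N P Q : Type u} [AddCommGroup N] [Module S N] [AddCommGroup P] [Module S P]
  [AddCommGroup Q] [Module S Q]

lemma smul_corner (x : corner φ N) : φ 1 • (x : N) = x := x.2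

lemma smul_mem_corner (a : R) (x : N) : φ a • x ∈ corner φ N := by
  change φ 1 • φ a • x = φ a • x
  rw [smul_smul, ← map_mul, one_mul]

instance : Module R (corner φ N) where
  smul a x := ⟨φ a • x, smul_mem_corner φ a _⟩
  one_smul x := Subtype.ext x.2
  mul_smul a b x := Subtype.ext (by
    change φ (a * b) • (x : N) = φ a • φ b • (x : N)
    rw [map_mul, mul_smul])
  smul_zero a := Subtype.ext (smul_zero (φ a))
  smul_add a x y := Subtype.ext (smul_add (φ a) (x : N) y)
  add_smul a b x := Subtype.ext (by
    change φ (a + b) • (x : N) = φ a • (x : N) + φ b • (x : N)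
    rw [map_add, add_smul])
  zero_smul x := Subtype.ext (by
    change φ 0 • (x : N) = 0
    rw [map_zero, zero_smul])

lemma coe_corner_smul (a : R) (x : corner φ N) : ((a • x : corner φ N) : N) = φ a • (x : N) := rfl

/-- The `R`-linear map induced on corners by an `S`-linear map. -/
def cornerMap (f : N →ₗ[S] P) : corner φ N →ₗ[R] corner φ P where
  toFun x := ⟨f x, by
    change φ 1 • f x = f x
    rw [← map_smul, smul_corner]⟩
  map_add' x y := Subtype.ext (map_add f (x : N) y)
  map_smul' a x := Subtype.ext (map_smul f (φ a) (x : N))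

lemma cornerMap_injective (f : N →ₗ[S] P) (hf : Function.Injective f) :
    Function.Injective (cornerMap φ f) :=
  fun _ _ h => Subtype.ext (hf (congrArg Subtype.val h))

lemma cornerMap_surjective (f : N →ₗ[S] P) (hf : Function.Surjective f) :
    Function.Surjective (cornerMap φ f) := by
  intro y
  obtain ⟨x, hx⟩ := hf y
  refine ⟨⟨φ 1 • x, smul_mem_corner φ 1 x⟩, Subtype.ext ?_⟩
  change f (φ 1 • x) = y
  rw [map_smul, hx, smul_corner]

lemma cornerMap_exact (f : N →ₗ[S] P) (g : P →ₗ[S] Q) (h : Function.Exact f g) :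
    Function.Exact (cornerMap φ f) (cornerMap φ g) := by
  intro y
  constructor
  · intro hy
    obtain ⟨x, hx⟩ := (h y).1 (congrArg Subtype.val hy)
    refine ⟨⟨φ 1 • x, smul_mem_corner φ 1 x⟩, Subtype.ext ?_⟩
    change f (φ 1 • x) = y
    rw [map_smul, hx, smul_corner]
  · rintro ⟨x, rfl⟩
    exact Subtype.ext (h.apply_apply_eq_zero x)

/-- The map from the corner of `I →₀ N` to the finitely supported functions with values in the
corner of `N`. -/
noncomputable def cornerFinsuppHom (I : Type u) : corner φ (I →₀ N) →ₗ[R] (I →₀ corner φ N) where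
  toFun x := (x : I →₀ N).mapRange (fun y => ⟨φ 1 • y, smul_mem_corner φ 1 y⟩)
    (Subtype.ext (smul_zero _))
  map_add' x y := by
    ext i
    exact smul_add (φ 1) ((x : I →₀ N) i) ((y : I →₀ N) i)
  map_smul' a x := by
    ext i
    change φ 1 • φ a • (x : I →₀ N) i = φ a • φ 1 • (x : I →₀ N) i
    rw [smul_smul, smul_smul, ← map_mul, ← map_mul, one_mul, mul_one]

/-- Finitely supported functions with values in a corner lie in the corner. -/
noncomputable def finsuppCornerHom (I : Type u) : (I →₀ corner φ N) →ₗ[R] corner φ (I →₀ N) where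
  toFun x := ⟨x.mapRange Subtype.val rfl, Finsupp.ext fun i => smul_corner φ (x i)⟩
  map_add' _ _ := Subtype.ext (Finsupp.ext fun _ => rfl)
  map_smul' _ _ := Subtype.ext (Finsupp.ext fun _ => rfl)

lemma finsuppCornerHom_leftInverse (I : Type u) :
    Function.LeftInverse (finsuppCornerHom φ (N := N) I) (cornerFinsuppHom φ I) := by
  intro x
  exact Subtype.ext (Finsupp.ext fun i => DFunLike.congr_fun (smul_corner φ x) i)

lemma hasProjectiveDimensionLT_corner_of_projective (r : ℕ)
    (hS : HasProjectiveDimensionLT (ModuleCat.of R (corner φ S)) (r + 1))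
    [Module.Projective S N] : HasProjectiveDimensionLT (ModuleCat.of R (corner φ N)) (r + 1) := by
  obtain ⟨s, hs⟩ := Module.projective_def'.1 (inferInstance : Module.Projective S N)
  refine hasProjectiveDimensionLT_of_leftInverse (cornerMap φ s)
    (cornerMap φ (Finsupp.linearCombination S id))
    (fun x => Subtype.ext (LinearMap.congr_fun hs (x : N))) _ ?_
  exact hasProjectiveDimensionLT_of_leftInverse (cornerFinsuppHom φ N) (finsuppCornerHom φ N)
    (finsuppCornerHom_leftInverse φ N) _ (hasProjectiveDimensionLT_finsupp N r _ hS)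

lemma hasProjectiveDimensionLT_corner (r d : ℕ)
    (hS : HasProjectiveDimensionLT (ModuleCat.of R (corner φ S)) (r + 1))
    (N : Type u) [AddCommGroup N] [Module S N]
    (hN : HasProjectiveDimensionLT (ModuleCat.of S N) (d + 1)) :
    HasProjectiveDimensionLT (ModuleCat.of R (corner φ N)) (d + r + 1) := by
  induction d generalizing N with
  | zero =>
    rw [zero_add, hasProjectiveDimensionLT_one_iff] at hN
    rw [zero_add]
    exact hasProjectiveDimensionLT_corner_of_projective φ r hS
  | succ d ih =>
    have hg := Finsupp.linearCombination_id_surjective S N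
    set g := Finsupp.linearCombination S (id : N → N)
    have hP := hasProjectiveDimensionLT_corner_of_projective φ (N := N →₀ S) r hS
    have hK := ih _ (hasProjectiveDimensionLT_ker_of_surjective g hg d hN)
    rw [show d + 1 + r + 1 = d + r + 1 + 1 by lia]
    exact hasProjectiveDimensionLT_right_of_exact (cornerMap φ (LinearMap.ker g).subtype)
      (cornerMap φ g) (cornerMap_injective φ _ (LinearMap.ker g).injective_subtype)
      (cornerMap_surjective φ g hg)
      (cornerMap_exact φ _ _ (LinearMap.exact_subtype_ker_map g)) _ hK
      (hasProjectiveDimensionLT_of_ge _ (r + 1) _ (by lia))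

/-- The coinduced module of an `R`-module along `φ`. -/
def Coind (N : Type u) [AddCommGroup N] [Module R N] : Type u := corner φ S →ₗ[R] N

variable (N : Type u) [AddCommGroup N] [Module R N]

instance : AddCommGroup (Coind φ N) := inferInstanceAs (AddCommGroup (corner φ S →ₗ[R] N))

variable {φ N} in
/-- The linear map underlying an element of the coinduced module. -/
def Coind.toLinearMap (f : Coind φ N) : corner φ S →ₗ[R] N := f

instance : Module S (Coind φ N) where
  smul s f := LinearMap.comp f (cornerMap φ (LinearMap.toSpanSingleton S S s))
  one_smul f := LinearMap.ext fun x =>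
    congrArg f.toLinearMap (Subtype.ext (mul_one (x : S)))
  mul_smul s t f := LinearMap.ext fun x =>
    congrArg f.toLinearMap (Subtype.ext (mul_assoc (x : S) s t).symm)
  smul_zero _ := LinearMap.zero_comp _
  smul_add _ _ _ := LinearMap.add_comp _ _ _
  add_smul s t f := LinearMap.ext fun x =>
    (congrArg f.toLinearMap (Subtype.ext (mul_add (x : S) s t))).trans
      (map_add f.toLinearMap _ _)
  zero_smul f := LinearMap.ext fun x =>
    (congrArg f.toLinearMap (Subtype.ext (mul_zero (x : S)))).trans
      (map_zero f.toLinearMap)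

/-- Evaluation of a coinduced function at the idempotent `φ 1`. -/
def cornerCoindEval : corner φ (Coind φ N) →ₗ[R] N where
  toFun f := f.1.toLinearMap ⟨φ 1, by simpa using smul_mem_corner φ 1 (1 : S)⟩
  map_add' f g := rfl
  map_smul' a f := by
    refine Eq.trans ?_ (map_smul f.1.toLinearMap a _)
    refine congrArg f.1.toLinearMap (Subtype.ext ?_)
    change φ 1 * φ a = φ a * φ 1
    rw [← map_mul, ← map_mul, one_mul, mul_one]

variable (hφ : Function.Injective φ) (ψ : S → R) (hψ : ∀ s, φ (ψ s) = φ 1 * s * φ 1)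

/-- When `φ` identifies `R` with `φ 1 * S * φ 1`, an `R`-module maps to the corner of its
coinduced module. -/
def toCornerCoind : N →ₗ[R] corner φ (Coind φ N) where
  toFun n :=
    ⟨show corner φ S →ₗ[R] N from
      { toFun := fun x => ψ x • n
        map_add' := fun x y => by
          rw [← add_smul]
          congr 1
          apply hφ
          simp only [hψ, map_add, AddSubgroup.coe_add, mul_add, add_mul]
        map_smul' := fun a x => by
          rw [RingHom.id_apply, smul_smul]
          congr 1
          apply hφ
          simp only [hψ, map_mul, coe_corner_smul, smul_eq_mul]
          simp only [← mul_assoc, ← map_mul, one_mul, mul_one] },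
      LinearMap.ext fun (x : corner φ S) => by
        change ψ ((x : S) * φ 1) • n = ψ (x : S) • n
        congr 1
        apply hφ
        simp only [hψ, mul_assoc, ← map_mul, mul_one]⟩
  map_add' m n := Subtype.ext (LinearMap.ext fun x => smul_add (ψ x) m n)
  map_smul' a n := Subtype.ext (LinearMap.ext fun x => by
    change ψ x • a • n = ψ ((x : S) * φ a) • n
    rw [smul_smul]
    congr 1
    apply hφ
    simp only [hψ, map_mul, mul_assoc]
    simp only [← map_mul, one_mul, mul_one])

include hφ hψ in
lemma gldimLE_of_corner (r d : ℕ)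
    (hS : HasProjectiveDimensionLT (ModuleCat.of R (corner φ S)) (r + 1)) (h : GldimLE S d) :
    GldimLE R (d + r) := by
  intro N
  refine projDimLE_of_hasProjectiveDimensionLT ?_
  refine hasProjectiveDimensionLT_of_leftInverse (toCornerCoind φ N hφ ψ hψ)
    (cornerCoindEval φ N) (fun n => ?_) _
    (hasProjectiveDimensionLT_corner φ r d hS _ (h (ModuleCat.of S _)).hasProjectiveDimensionLT)
  change ψ (φ 1) • n = n
  have : ψ (φ 1) = 1 := hφ (by simp only [hψ, ← map_mul, one_mul])
  rw [this, one_smul]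

end Corner

section Hom

variable {C : Type*} [Category.{u} C] [Preadditive C]

/-- The embedding of endomorphism rings induced by a retract. -/
def retractEndHom {A B : C} (h : Retract A B) : End A →ₙ+* End B where
  toFun a := h.r ≫ a ≫ h.i
  map_mul' a b := by
    change h.r ≫ (b ≫ a) ≫ h.i = (h.r ≫ b ≫ h.i) ≫ h.r ≫ a ≫ h.i
    simp
  map_zero' := by
    change h.r ≫ (0 : A ⟶ A) ≫ h.i = (0 : B ⟶ B)
    simp
  map_add' a b := by
    exact (congrArg (h.r ≫ ·) (Preadditive.add_comp _ _ _ a b h.i)).trans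
      (Preadditive.comp_add _ _ _ _ _ _)

/-- Precomposition with a morphism, as a linear map over the endomorphism ring of the target. -/
def precompHom {A B : C} (u : B ⟶ A) (Y : C) : (A ⟶ Y) →ₗ[End Y] (B ⟶ Y) where
  toFun f := u ≫ f
  map_add' _ _ := Preadditive.comp_add _ _ _ _ _ _
  map_smul' _ _ := (Category.assoc _ _ _).symm

lemma gldimLE_of_retract {A B : C} (h : Retract A B) (r d : ℕ)
    (hA : HasProjectiveDimensionLT (ModuleCat.of (End A) (B ⟶ A)) (r + 1))
    (hd : GldimLE (End B) d) : GldimLE (End A) (d + r) := by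
  have h1 : retractEndHom h 1 = h.r ≫ h.i := congrArg (h.r ≫ ·) (Category.id_comp h.i)
  refine gldimLE_of_corner (retractEndHom h) (fun a b hab => ?_) (fun s => h.i ≫ s ≫ h.r)
    (fun s => ?_) r d ?_ hd
  · have := congrArg (fun t : B ⟶ B => h.i ≫ t ≫ h.r) hab
    change h.i ≫ (h.r ≫ a ≫ h.i) ≫ h.r = h.i ≫ (h.r ≫ b ≫ h.i) ≫ h.r at this
    simpa using this
  · rw [h1]
    change h.r ≫ (h.i ≫ s ≫ h.r) ≫ h.i = (h.r ≫ h.i) ≫ s ≫ h.r ≫ h.i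
    simp
  · let i : corner (retractEndHom h) (End B) →ₗ[End A] (B ⟶ A) :=
      { toFun := fun x => x.1 ≫ h.r
        map_add' := fun x y => Preadditive.add_comp _ _ _ _ _ _
        map_smul' := fun a x => by
          change (x.1 ≫ h.r ≫ a ≫ h.i) ≫ h.r = (x.1 ≫ h.r) ≫ a
          simp }
    let p : (B ⟶ A) →ₗ[End A] corner (retractEndHom h) (End B) :=
      { toFun := fun y => ⟨y ≫ h.i, by
          change (y ≫ h.i) ≫ retractEndHom h 1 = y ≫ h.i
          rw [h1]
          simp⟩
        map_add' := fun x y => Subtype.ext (Preadditive.add_comp _ _ _ _ _ _)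
        map_smul' := fun a y => Subtype.ext (by
          change (y ≫ a) ≫ h.i = (y ≫ h.i) ≫ h.r ≫ a ≫ h.i
          simp) }
    refine hasProjectiveDimensionLT_of_leftInverse i p (fun x => Subtype.ext ?_) _ hA
    have hx : x.1 ≫ retractEndHom h 1 = x.1 := x.2
    change (x.1 ≫ h.r) ≫ h.i = x.1
    rw [h1] at hx
    rw [Category.assoc]
    exact hx

end Hom

section Syzygy

variable {Λ}

lemma inAdd_self (M : ModuleCat.{u} Λ) : InAdd Λ M M :=
  ⟨1, ModuleCat.of Λ PUnit, ⟨(isoBiprodZero (ModuleCat.isZero_of_subsingleton _)).symm ≪≫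
    (biproductUniqueIso (fun _ : Fin 1 => M)).symm⟩⟩

lemma projective_hom_of_inAdd {M A : ModuleCat.{u} Λ} (h : InAdd Λ M A) :
    Module.Projective (End (op M)) (op A ⟶ op M) := by
  obtain ⟨n, Y, ⟨e⟩⟩ := h
  let i : (op A ⟶ op M) →ₗ[End (op M)] (Fin n → End (op M)) :=
    LinearMap.pi fun j => precompHom (biprod.inl ≫ e.hom ≫ biproduct.π (fun _ : Fin n => M) j).op (op M)
  let p : (Fin n → End (op M)) →ₗ[End (op M)] (op A ⟶ op M) :=
    ∑ j, (precompHom (biproduct.ι (fun _ : Fin n => M) j ≫ e.inv ≫ biprod.fst).op (op M)).comp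
      (LinearMap.proj j)
  have htotal : ∑ j, (biprod.inl ≫ e.hom ≫ biproduct.π (fun _ : Fin n => M) j) ≫
      biproduct.ι (fun _ : Fin n => M) j ≫ e.inv ≫ biprod.fst = 𝟙 A := by
    have := biproduct.total (f := fun _ : Fin n => M)
    calc _ = (biprod.inl ≫ e.hom) ≫ (∑ j, biproduct.π (fun _ : Fin n => M) j ≫
          biproduct.ι (fun _ : Fin n => M) j) ≫ e.inv ≫ biprod.fst := by
            simp only [Preadditive.sum_comp, Preadditive.comp_sum, Category.assoc]
      _ = 𝟙 A := by simp [this]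
  refine Module.Projective.of_split i p (LinearMap.ext fun f => Quiver.Hom.unop_inj ?_)
  calc (p (i f)).unop = (∑ j, (biproduct.ι (fun _ : Fin n => M) j ≫ e.inv ≫ biprod.fst).op ≫
        (biprod.inl ≫ e.hom ≫ biproduct.π (fun _ : Fin n => M) j).op ≫ f).unop :=
          congrArg Quiver.Hom.unop (LinearMap.sum_apply _ _ _)
    _ = f.unop ≫ ∑ j, (biprod.inl ≫ e.hom ≫ biproduct.π (fun _ : Fin n => M) j) ≫
        biproduct.ι (fun _ : Fin n => M) j ≫ e.inv ≫ biprod.fst := by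
          rw [unop_sum, Preadditive.comp_sum]
          simp
    _ = f.unop := by rw [htotal, Category.comp_id]

lemma IsMSyzygy.hasProjectiveDimensionLT_hom {M X W : ModuleCat.{u} Λ} {r : ℕ}
    (h : IsMSyzygy Λ M X r W) (n : ℕ)
    (hW : HasProjectiveDimensionLT (ModuleCat.of (End (op M)) (op W ⟶ op M)) (n + 1)) :
    HasProjectiveDimensionLT (ModuleCat.of (End (op M)) (op X ⟶ op M)) (n + r + 1) := by
  induction h generalizing n with
  | zero => exact hW
  | succ r W A g _ hg ih =>
    rw [show n + (r + 1) + 1 = n + 1 + r + 1 by lia]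
    refine ih (n + 1) ?_
    have hA : HasProjectiveDimensionLT (ModuleCat.of (End (op M)) (op A ⟶ op M)) 1 :=
      (hasProjectiveDimensionLT_one_iff _).2 (projective_hom_of_inAdd hg.1)
    refine hasProjectiveDimensionLT_right_of_exact (precompHom (kernel.ι g).op (op M))
      (precompHom g.op (op M)) ?_ ?_ ?_ _ hW (hasProjectiveDimensionLT_of_ge _ 1 _ (by lia))
    · intro a b hab
      exact (cancel_epi (kernel.ι g).op).1 hab
    · intro f
      obtain ⟨h, hh⟩ := hg.2.1 M (inAdd_self M) f.unop
      exact ⟨h.op, Quiver.Hom.unop_inj hh⟩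
    · intro f
      constructor
      · intro hf
        have hf' : f.unop ≫ g = 0 := congrArg Quiver.Hom.unop hf
        exact ⟨(kernel.lift g f.unop hf').op, Quiver.Hom.unop_inj (kernel.lift_ι g _ hf')⟩
      · rintro ⟨y, rfl⟩
        refine Quiver.Hom.unop_inj ?_
        change (y.unop ≫ kernel.ι g) ≫ g = 0
        simp

lemma MdimLE.gldimLE {M X : ModuleCat.{u} Λ} {r : ℕ} (h : MdimLE Λ M X r) {d : ℕ}
    (hd : GldimLE (End (op (M ⊞ X))) d) : GldimLE (End (op M)) (d + r) := by
  obtain ⟨W, hW, hWM⟩ := h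
  have hX := hW.hasProjectiveDimensionLT_hom 0
    ((hasProjectiveDimensionLT_one_iff _).2 (projective_hom_of_inAdd hWM))
  rw [zero_add] at hX
  have hM : HasProjectiveDimensionLT (ModuleCat.of (End (op M)) (op M ⟶ op M)) (r + 1) :=
    have : HasProjectiveDimensionLT (ModuleCat.of (End (op M)) (op M ⟶ op M)) 1 :=
      (hasProjectiveDimensionLT_one_iff _).2 (projective_hom_of_inAdd (inAdd_self M))
    hasProjectiveDimensionLT_of_ge _ 1 _ (by lia)
  let ρ : Retract (op M) (op (M ⊞ X)) :=
    { i := (biprod.fst : M ⊞ X ⟶ M).op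
      r := (biprod.inl : M ⟶ M ⊞ X).op
      retract := Quiver.Hom.unop_inj biprod.inl_fst }
  refine gldimLE_of_retract ρ r d ?_ hd
  refine (ModuleCat.shortComplex_shortExact (ModuleCat.shortComplexOfCompEqZero
    (precompHom (biprod.inl : M ⟶ M ⊞ X).op (op M)) (precompHom (biprod.snd : M ⊞ X ⟶ X).op (op M))
    (LinearMap.ext fun y => Quiver.Hom.unop_inj ?_)) ?_ ?_ ?_).hasProjectiveDimensionLT_X₂ _ hM hX
  · change (y.unop ≫ biprod.inl) ≫ biprod.snd = 0
    simp
  · intro f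
    constructor
    · intro hf
      have hf' : f.unop ≫ biprod.snd = 0 := congrArg Quiver.Hom.unop hf
      refine ⟨(f.unop ≫ biprod.fst).op, Quiver.Hom.unop_inj ?_⟩
      change (f.unop ≫ biprod.fst) ≫ biprod.inl = f.unop
      apply biprod.hom_ext <;> simp [hf']
    · rintro ⟨y, rfl⟩
      refine Quiver.Hom.unop_inj ?_
      change (y.unop ≫ biprod.inl) ≫ biprod.snd = 0
      simp
  · intro a b hab
    exact (cancel_epi (biprod.inl : M ⟶ M ⊞ X).op).1 hab
  · intro f
    refine ⟨(f.unop ≫ biprod.inr).op, Quiver.Hom.unop_inj ?_⟩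
    change (f.unop ≫ biprod.inr) ≫ biprod.snd = f.unop
    simp

end Syzygy

/-- Proposition `dim_prop`: if `M` is a generator-cogenerator and `X` has
`M`-dimension `r < ∞`, then `gldim End_Λ(M) ≤ gldim End_Λ(M ⊕ X) + r`. -/
theorem statement1 (k : Type u) [Field k] (Λ : Type u) [Ring Λ] [Algebra k Λ]
    [FiniteDimensional k Λ]
    (M X : ModuleCat.{u} Λ) (hMfin : Module.Finite Λ M) (hXfin : Module.Finite Λ X)
    (hgc : IsGenCogen Λ M) (r : ℕ) (hX : MdimLE Λ M X r) :
    gldim (End (op M)) ≤ gldim (End (op (M ⊞ X))) + (r : ℕ∞) := by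
  by_cases h : ∃ d : ℕ, gldim (End (op (M ⊞ X))) = d ∧ GldimLE (End (op (M ⊞ X))) d
  · obtain ⟨d, hd, hd'⟩ := h
    rw [hd]
    exact sInf_le ⟨d + r, by push_cast; rfl, hX.gldimLE hd'⟩
  · have : {c : ℕ∞ | ∃ d : ℕ, c = (d : ℕ∞) ∧ GldimLE (End (op (M ⊞ X))) d} = ∅ := by
      by_contra hne
      exact h (csInf_mem (Set.nonempty_iff_ne_empty.2 hne))
    rw [gldim.eq_1 (End (op (M ⊞ X))), this, sInf_empty, top_add]
    exact le_top

end Rigidity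
end

section
/- Let 0 → X → Y → Z → 0 be an Auslander-Reiten sequence over an Artin algebra Λ, and let M be a generator-cogenerator with Y ∈ add(M). Set N = M ⊕ X ⊕ Z. If X ∈ add(M) or Z ∈ add(M), then 0 ≤ gldim End_Λ(M) − gldim End_Λ(N) ≤ 1; in particular End_Λ(M) has finite global dimension if and only if End_Λ(N) does. -/
open CategoryTheory CategoryTheory.Limits Opposite

universe u

namespace Rigidity

variable (Λ : Type u) [Ring Λ]

theorem shortExact_kernel {C : Type*} [Category C] [Abelian C] {A B : C} (p : A ⟶ B) [Epi p] :
    (ShortComplex.mk (kernel.ι p) p (kernel.condition p)).ShortExact :=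
  { exact := ShortComplex.exact_kernel p }

theorem ProjDimLE.hasProjectiveDimensionLE {A : Type u} [Ring A] {N : ModuleCat.{u} A} {r : ℕ}
    (h : ProjDimLE A N r) : HasProjectiveDimensionLE N r := by
  induction r generalizing N with
  | zero =>
    obtain ⟨P, d, f, hP, hz, hf, ⟨w, hw⟩, -⟩ := h
    have : Mono f := hw.mono_g ((hz 1 one_pos).eq_of_src _ _)
    have : IsIso f := isIso_of_mono_of_epi f
    have := hP 0
    exact (projective_iff_hasProjectiveDimensionLE_zero _).1 (Projective.of_iso (asIso f) (hP 0))
  | succ r ih =>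
    obtain ⟨P, d, f, hP, hz, hf, ⟨w, hw⟩, hd⟩ := h
    have hK : ProjDimLE A (kernel f) r := by
      refine ⟨fun i ↦ P (i + 1), fun i ↦ d (i + 1), kernel.lift f (d 0) w, fun i ↦ hP _,
        fun i hi ↦ hz _ (by lia), hw.epi_kernelLift, ?_, fun i ↦ hd _⟩
      obtain ⟨w', hw'⟩ := hd 0
      have e : d 1 ≫ kernel.lift f (d 0) w = 0 := by
        rw [← cancel_mono (kernel.ι f)]; simpa using w'
      refine ⟨e, ?_⟩
      refine (ShortComplex.exact_iff_of_epi_of_isIso_of_mono (S₁ := .mk _ _ e) (S₂ := .mk _ _ w')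
        ⟨𝟙 _, 𝟙 _, kernel.ι f, by simp, by simp⟩).2 hw'
    have := hP 0
    exact ((shortExact_kernel f).hasProjectiveDimensionLT_X₃_iff r (hP 0)).2 (ih hK)

theorem projDimLE_of_hasProjectiveDimensionLE {A : Type u} [Ring A] {N : ModuleCat.{u} A} {r : ℕ}
    (h : HasProjectiveDimensionLE N r) : ProjDimLE A N r := by
  induction r generalizing N with
  | zero =>
    have hz : IsZero (ModuleCat.of A PUnit.{u + 1}) := ModuleCat.isZero_of_subsingleton _
    refine ⟨fun i ↦ match i with | 0 => N | _ + 1 => ModuleCat.of A PUnit, fun _ ↦ 0, 𝟙 N, ?_, ?_,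
      inferInstance, ⟨by simp, (ShortComplex.exact_iff_mono _ rfl).2 (inferInstance : Mono (𝟙 N))⟩,
      fun i ↦ ⟨by simp, ShortComplex.exact_of_isZero_X₂ _ hz⟩⟩
    · rintro (_ | i)
      · exact (projective_iff_hasProjectiveDimensionLE_zero _).2 h
      · exact Projective.of_iso (hz.iso (isZero_zero _)).symm Projective.zero_projective
    · rintro (_ | i) hi
      · lia
      · exact hz
  | succ r ih =>
    obtain ⟨P, d, f, hP, hz, hf, ⟨w, hw⟩, hd⟩ := ih
      (((shortExact_kernel (Projective.π N)).hasProjectiveDimensionLT_X₃_iff r inferInstance).1 h)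
    refine ⟨fun i ↦ match i with | 0 => Projective.over N | i + 1 => P i,
      fun i ↦ match i with | 0 => f ≫ kernel.ι _ | i + 1 => d i, Projective.π N, ?_, ?_,
      inferInstance, ⟨by simp, ?_⟩, ?_⟩
    · rintro (_ | i)
      · exact Projective.projective_over N
      · exact hP i
    · rintro (_ | i) hi
      · lia
      · exact hz i (by lia)
    · exact (ShortComplex.exact_iff_of_epi_of_isIso_of_mono
        (S₁ := .mk (f ≫ kernel.ι (Projective.π N)) (Projective.π N) (by simp))
        (S₂ := .mk (kernel.ι (Projective.π N)) (Projective.π N) (kernel.condition _))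
        ⟨f, 𝟙 _, 𝟙 _, by simp, by simp⟩).2 (ShortComplex.exact_kernel _)
    · rintro (_ | i)
      · refine ⟨by simp [reassoc_of% w], ?_⟩
        exact (ShortComplex.exact_iff_of_epi_of_isIso_of_mono (S₁ := .mk _ _ w)
          (S₂ := .mk (d 0) (f ≫ kernel.ι (Projective.π N)) (by simp [reassoc_of% w]))
          ⟨𝟙 _, 𝟙 _, kernel.ι _, by simp, by simp⟩).1 hw
      · exact hd i

theorem gldimLE_iff {A : Type u} [Ring A] {r : ℕ} :
    GldimLE A r ↔ ∀ N : ModuleCat.{u} A, HasProjectiveDimensionLE N r :=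
  forall_congr' fun _ ↦ ⟨(·.hasProjectiveDimensionLE), projDimLE_of_hasProjectiveDimensionLE⟩

theorem injective_of_ext_quotient {A : Type u} [Ring A] (Q : ModuleCat.{u} A)
    (h : ∀ I : Ideal A, Subsingleton (Abelian.Ext (ModuleCat.of A (A ⧸ I)) Q 1)) :
    Injective Q := by
  have hB : Module.Baer A Q := by
    intro I φ
    have hS : (ShortComplex.mk (ModuleCat.ofHom I.subtype) (ModuleCat.ofHom I.mkQ) (by
        ext x; simp)).ShortExact :=
      ModuleCat.shortComplex_shortExact _ (I.subtype.exact_iff.2 (by simp)) I.injective_subtype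
        I.mkQ_surjective
    obtain ⟨x, hx⟩ := Abelian.Ext.contravariant_sequence_exact₁ hS Q
      (Abelian.Ext.mk₀ (ModuleCat.ofHom φ)) (n₁ := 1) (by simp) (Subsingleton.elim _ _)
    obtain ⟨x, rfl⟩ := Abelian.Ext.mk₀_bijective _ _ |>.2 x
    rw [Abelian.Ext.mk₀_comp_mk₀] at hx
    have hx' := (Abelian.Ext.mk₀_bijective _ _).1 hx
    refine ⟨x.hom, fun y hy ↦ ?_⟩
    exact congr($(hx') ⟨y, hy⟩)
  have := hB.injective
  exact Module.injective_object_of_injective_module A Q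

theorem hasInjectiveDimensionLE_of_ext_quotient {A : Type u} [Ring A] (Q : ModuleCat.{u} A)
    (r : ℕ) (h : ∀ I : Ideal A, Subsingleton (Abelian.Ext (ModuleCat.of A (A ⧸ I)) Q (r + 1))) :
    HasInjectiveDimensionLE Q r := by
  induction r generalizing Q with
  | zero =>
    have := injective_of_ext_quotient Q h
    infer_instance
  | succ r ih =>
    have hS : (ShortComplex.mk _ _ (cokernel.condition (Injective.ι Q))).ShortExact :=
      { exact := ShortComplex.exact_cokernel _ }
    refine (hS.hasInjectiveDimensionLT_X₃_iff r inferInstance).1 (ih _ fun I ↦ ?_)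
    refine ⟨fun a b ↦ ?_⟩
    rw [← sub_eq_zero]
    obtain ⟨x, hx⟩ := Abelian.Ext.covariant_sequence_exact₃ _ hS (a - b) rfl
      (Subsingleton.elim _ _)
    rw [← hx, Abelian.Ext.eq_zero_of_injective x, Abelian.Ext.zero_comp]

/-- Auslander: the global dimension is detected on cyclic modules. -/
theorem gldimLE_of_quotient {A : Type u} [Ring A] {r : ℕ}
    (h : ∀ I : Ideal A, HasProjectiveDimensionLE (ModuleCat.of A (A ⧸ I)) r) :
    GldimLE A r := by
  rw [gldimLE_iff]
  intro N
  refine HasProjectiveDimensionLT.mk fun i hi Q e ↦ ?_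
  have : HasInjectiveDimensionLE Q r :=
    hasInjectiveDimensionLE_of_ext_quotient Q r fun I ↦
      (h I).subsingleton _ _ _ le_rfl Q
  exact Abelian.Ext.eq_zero_of_hasInjectiveDimensionLT e _ hi

section HomFunctor

universe v

attribute [local instance] Abelian.hasFiniteBiproducts

variable {C : Type*} [Category.{v} C] [Abelian C] (M : C)

/-- The functor `Hom(M, -)`, with values in the left modules over `End (op M)`. -/
def homFunctor : C ⥤ ModuleCat.{v} (End (op M)) :=
  opOp C ⋙ preadditiveYonedaObj (op M)

instance : (homFunctor M).Additive where
  map_add {_ _ f g} := by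
    ext x
    exact Quiver.Hom.unop_inj (Preadditive.comp_add _ _ _ (Quiver.Hom.unop x) f g)

/-- The morphism `M ⟶ W` underlying an element of `Hom(M, W)`. -/
def toHom {W : C} (x : (homFunctor M).obj W) : M ⟶ W := Quiver.Hom.unop x

/-- A morphism `M ⟶ W` as an element of `Hom(M, W)`. -/
def ofHom {W : C} (φ : M ⟶ W) : (homFunctor M).obj W := φ.op

variable {M}

@[simp] theorem toHom_ofHom {W : C} (φ : M ⟶ W) : toHom M (ofHom M φ) = φ := rfl

@[simp] theorem ofHom_toHom {W : C} (x : (homFunctor M).obj W) : ofHom M (toHom M x) = x := rfl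

theorem map_ofHom {W W' : C} (h : W ⟶ W') (φ : M ⟶ W) :
    (homFunctor M).map h (ofHom M φ) = ofHom M (φ ≫ h) := rfl

theorem toHom_map {W W' : C} (h : W ⟶ W') (x : (homFunctor M).obj W) :
    toHom M ((homFunctor M).map h x) = toHom M x ≫ h := rfl

theorem toHom_injective {W : C} : Function.Injective (toHom M (W := W)) :=
  Quiver.Hom.unop_inj

@[simp] theorem toHom_zero {W : C} : toHom M (0 : (homFunctor M).obj W) = 0 := rfl

theorem smul_ofHom {W : C} (a : End (op M)) (φ : M ⟶ W) :
    a • ofHom M φ = ofHom M (Quiver.Hom.unop a ≫ φ) := rfl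

/-- Every morphism from `T` to `W` lifts along `p`. -/
def Lifts (T : C) {A W : C} (p : A ⟶ W) : Prop :=
  ∀ φ : T ⟶ W, ∃ ψ : T ⟶ A, ψ ≫ p = φ

/-- `X` is a retract of a finite direct sum of copies of `M`. -/
def IsRetractOfSum (M X : C) : Prop :=
  ∃ r : ℕ, Nonempty (Retract X (⨁ fun _ : Fin r ↦ M))

theorem epi_map_iff_lifts {A W : C} (p : A ⟶ W) : Epi ((homFunctor M).map p) ↔ Lifts M p := by
  rw [ModuleCat.epi_iff_surjective]
  constructor
  · intro h φ
    obtain ⟨x, hx⟩ := h (ofHom M φ)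
    exact ⟨toHom M x, congr(toHom M $hx)⟩
  · intro h y
    obtain ⟨ψ, hψ⟩ := h (toHom M y)
    exact ⟨ofHom M ψ, by rw [map_ofHom, hψ, ofHom_toHom]⟩

theorem Lifts.biprod {T T' A W : C} {p : A ⟶ W} (h : Lifts T p) (h' : Lifts T' p) :
    Lifts (T ⊞ T') p := fun φ ↦ by
  obtain ⟨a, ha⟩ := h (biprod.inl ≫ φ)
  obtain ⟨b, hb⟩ := h' (biprod.inr ≫ φ)
  exact ⟨biprod.desc a b, by ext <;> simp [ha, hb]⟩

theorem Lifts.retract {D : Type*} [Category D] {T T' A W : D} {p : A ⟶ W}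
    (h : Lifts T p) (e : Retract T' T) :
    Lifts T' p := fun φ ↦ by
  obtain ⟨a, ha⟩ := h (e.r ≫ φ)
  exact ⟨e.i ≫ a, by simp [ha]⟩

theorem Lifts.of_isRetractOfSum {T A W : C} {p : A ⟶ W} (h : Lifts M p)
    (hT : IsRetractOfSum M T) : Lifts T p := by
  obtain ⟨r, ⟨e⟩⟩ := hT
  refine Lifts.retract (fun φ ↦ ?_) e
  choose a ha using fun i : Fin r ↦ h (biproduct.ι (fun _ : Fin r ↦ M) i ≫ φ)
  exact ⟨biproduct.desc a, by ext i; simp [ha]⟩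

theorem IsRetractOfSum.retract {T T' : C} (h : IsRetractOfSum M T) (e : Retract T' T) :
    IsRetractOfSum M T' := by
  obtain ⟨r, ⟨e'⟩⟩ := h
  exact ⟨r, ⟨e.trans e'⟩⟩

theorem isRetractOfSum_self (M : C) : IsRetractOfSum M M :=
  ⟨1, ⟨{ i := biproduct.ι (fun _ : Fin 1 ↦ M) 0, r := biproduct.π (fun _ : Fin 1 ↦ M) 0 }⟩⟩

theorem isRetractOfSum_biproduct (M : C) (r : ℕ) : IsRetractOfSum M (⨁ fun _ : Fin r ↦ M) :=
  ⟨r, ⟨Retract.refl _⟩⟩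

theorem isRetractOfSum_of_sum {X : C} {ι : Type*} [Fintype ι] (a : ι → (X ⟶ M)) (b : ι → (M ⟶ X))
    (h : ∑ i, a i ≫ b i = 𝟙 X) : IsRetractOfSum M X := by
  let e := (Fintype.equivFin ι).symm
  refine ⟨Fintype.card ι, ⟨{
    i := biproduct.lift (f := fun _ : Fin (Fintype.card ι) ↦ M) (fun i ↦ a (e i))
    r := biproduct.desc (fun i ↦ b (e i))
    retract := ?_ }⟩⟩
  rw [biproduct.lift_desc, ← h]
  exact e.sum_comp fun i ↦ a i ≫ b i

theorem IsRetractOfSum.exists_sum {X : C} (h : IsRetractOfSum M X) :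
    ∃ (r : ℕ) (a : Fin r → (X ⟶ M)) (b : Fin r → (M ⟶ X)), ∑ i, a i ≫ b i = 𝟙 X := by
  obtain ⟨r, ⟨e⟩⟩ := h
  refine ⟨r, fun i ↦ e.i ≫ biproduct.π (fun _ : Fin r ↦ M) i,
    fun i ↦ biproduct.ι (fun _ : Fin r ↦ M) i ≫ e.r, ?_⟩
  have := congr(e.i ≫ $(biproduct.total (f := fun _ : Fin r ↦ M)) ≫ e.r)
  rw [Category.id_comp, e.retract] at this
  simpa only [Preadditive.comp_sum, Preadditive.sum_comp, Category.assoc] using this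

theorem IsRetractOfSum.biprod {T T' : C} (h : IsRetractOfSum M T) (h' : IsRetractOfSum M T') :
    IsRetractOfSum M (T ⊞ T') := by
  obtain ⟨r, a, b, hab⟩ := h.exists_sum
  obtain ⟨s, a', b', hab'⟩ := h'.exists_sum
  refine isRetractOfSum_of_sum (ι := Fin r ⊕ Fin s)
    (Sum.elim (fun i ↦ biprod.fst ≫ a i) (fun i ↦ biprod.snd ≫ a' i))
    (Sum.elim (fun i ↦ b i ≫ biprod.inl) (fun i ↦ b' i ≫ biprod.inr)) ?_
  have e := congr(biprod.fst ≫ $hab ≫ biprod.inl (X := T) (Y := T') +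
    biprod.snd ≫ $hab' ≫ biprod.inr (X := T) (Y := T'))
  simpa [Preadditive.comp_sum, Preadditive.sum_comp, biprod.total] using e

theorem IsRetractOfSum.trans {N T : C} (h : IsRetractOfSum M T) (hM : IsRetractOfSum N M) :
    IsRetractOfSum N T := by
  obtain ⟨r, a, b, hab⟩ := h.exists_sum
  obtain ⟨s, c, d, hcd⟩ := hM.exists_sum
  refine isRetractOfSum_of_sum (ι := Fin r × Fin s) (fun i ↦ a i.1 ≫ c i.2)
    (fun i ↦ d i.2 ≫ b i.1) ?_
  rw [← hab, Fintype.sum_prod_type]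
  refine Finset.sum_congr rfl fun i _ ↦ ?_
  have := congr(a i ≫ $hcd ≫ b i)
  simpa [Preadditive.comp_sum, Preadditive.sum_comp] using this

theorem projective_homFunctor_self : Projective ((homFunctor M).obj M) := by
  have : Projective (ModuleCat.of (End (op M)) (End (op M))) :=
    ModuleCat.projective_of_free (Module.Basis.singleton PUnit.{v+1} (End (op M)))
  exact this

theorem projective_biproduct {D β : Type*} [Category D] [HasZeroMorphisms D] (F : β → D)
    [HasBiproduct F] (h : ∀ i, Projective (F i)) : Projective (⨁ F) where
  factors f p _ := ⟨biproduct.desc fun i ↦ Projective.factorThru (biproduct.ι F i ≫ f) p, by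
    ext i; simp⟩

theorem IsRetractOfSum.projective {T : C} (h : IsRetractOfSum M T) :
    Projective ((homFunctor M).obj T) := by
  obtain ⟨r, ⟨e⟩⟩ := h
  have := projective_homFunctor_self (M := M)
  have := Projective.of_iso ((homFunctor M).mapBiproduct fun _ : Fin r ↦ M).symm
    (projective_biproduct _ fun _ ↦ this)
  exact (e.map (homFunctor M)).projective

theorem IsRetractOfSum.exists_map_eq {T W : C} (h : IsRetractOfSum M T)
    (φ : (homFunctor M).obj T ⟶ (homFunctor M).obj W) : ∃ f, (homFunctor M).map f = φ := by
  obtain ⟨r, ⟨e⟩⟩ := h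
  have key : ∀ φ : (homFunctor M).obj M ⟶ (homFunctor M).obj W,
      ∃ f, (homFunctor M).map f = φ := fun φ ↦ by
    refine ⟨toHom M (φ (ofHom M (𝟙 M))), ?_⟩
    refine ConcreteCategory.hom_ext _ _ fun x ↦ ?_
    have := φ.hom.map_smul (toHom M x).op (ofHom M (𝟙 M))
    rw [smul_ofHom] at this
    simp only [Quiver.Hom.unop_op, Category.comp_id, ofHom_toHom] at this
    exact this.symm
  choose f hf using fun i : Fin r ↦
    key ((homFunctor M).map (biproduct.ι (fun _ : Fin r ↦ M) i ≫ e.r) ≫ φ)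
  refine ⟨e.i ≫ biproduct.desc f, ?_⟩
  have : biproduct.desc f = ∑ i, biproduct.π (fun _ : Fin r ↦ M) i ≫ f i := by
    ext i; simp [biproduct.ι_π_assoc, Preadditive.comp_sum, ite_comp]
  rw [this, Functor.map_comp, Functor.map_sum]
  simp only [Functor.map_comp, hf]
  simp only [← Category.assoc, ← Preadditive.sum_comp, ← Functor.map_comp, ← Functor.map_sum,
    biproduct.total]
  simp

variable (M) in
/-- `W` has projective dimension at most `n` relative to `M`. -/
abbrev RelDimLE (W : C) (n : ℕ) : Prop :=
  HasProjectiveDimensionLE ((homFunctor M).obj W) n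

theorem RelDimLE.retract {W W' : C} {n : ℕ} (h : RelDimLE M W n) (e : Retract W' W) :
    RelDimLE M W' n :=
  (e.map (homFunctor M)).hasProjectiveDimensionLT _

theorem RelDimLE.biprod {W W' : C} {n : ℕ} (h : RelDimLE M W n) (h' : RelDimLE M W' n) :
    RelDimLE M (W ⊞ W') n :=
  have := preservesBinaryBiproducts_of_preservesBiproducts (homFunctor M)
  hasProjectiveDimensionLT_of_iso ((homFunctor M).mapBiprod W W').symm _

theorem RelDimLE.mono {W : C} {n m : ℕ} (h : RelDimLE M W n) (hnm : n ≤ m) : RelDimLE M W m :=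
  hasProjectiveDimensionLT_of_ge _ (n + 1) _ (by lia)

theorem RelDimLE.of_isRetractOfSum {T : C} (h : IsRetractOfSum M T) (n : ℕ) : RelDimLE M T n :=
  have := h.projective
  RelDimLE.mono (n := 0) ((projective_iff_hasProjectiveDimensionLE_zero _).1 this) n.zero_le

theorem RelDimLE.of_isRetractOfSum_of {N T : C} {n : ℕ} (hN : RelDimLE M N n)
    (hT : IsRetractOfSum N T) : RelDimLE M T n := by
  obtain ⟨r, a, b, hab⟩ := hT.exists_sum
  refine HasProjectiveDimensionLT.mk fun i hi Q e ↦ ?_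
  let φ : ((homFunctor M).obj T ⟶ (homFunctor M).obj T) →+
      Abelian.Ext ((homFunctor M).obj T) Q i :=
    { toFun := fun φ ↦ (Abelian.Ext.mk₀ φ).comp e (zero_add i)
      map_zero' := by simp
      map_add' := fun _ _ ↦ by rw [Abelian.Ext.mk₀_add, Abelian.Ext.add_comp] }
  have h1 : φ (𝟙 _) = e := Abelian.Ext.mk₀_id_comp e
  rw [← h1, ← CategoryTheory.Functor.map_id, ← hab, Functor.map_sum, map_sum]
  refine Finset.sum_eq_zero fun j _ ↦ ?_
  change (Abelian.Ext.mk₀ _).comp e (zero_add i) = 0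
  rw [Functor.map_comp, ← Abelian.Ext.mk₀_comp_mk₀_assoc,
    Abelian.Ext.eq_zero_of_hasProjectiveDimensionLT ((Abelian.Ext.mk₀ _).comp e (zero_add i))
      (n + 1) hi, Abelian.Ext.comp_zero]

theorem shortExact_map_kernel {A W : C} {p : A ⟶ W} (h : Lifts M p) :
    (ShortComplex.mk ((homFunctor M).map (kernel.ι p)) ((homFunctor M).map p)
      (by rw [← Functor.map_comp, kernel.condition, Functor.map_zero])).ShortExact := by
  refine ModuleCat.shortComplex_shortExact _ (fun y ↦ ⟨fun hy ↦ ?_, ?_⟩) (fun x y hxy ↦ ?_)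
    ((ModuleCat.epi_iff_surjective _).1 ((epi_map_iff_lifts p).2 h))
  · have hy' : toHom M y ≫ p = 0 := congr(toHom M $hy)
    exact ⟨ofHom M (kernel.lift p _ hy'), toHom_injective (kernel.lift_ι p _ hy')⟩
  · rintro ⟨x, rfl⟩
    refine toHom_injective ?_
    change (toHom M x ≫ kernel.ι p) ≫ p = 0
    simp
  · have : toHom M x ≫ kernel.ι p = toHom M y ≫ kernel.ι p := congr(toHom M $hxy)
    exact toHom_injective ((cancel_mono _).1 this)

theorem RelDimLE.of_kernel {A W : C} {p : A ⟶ W} {n : ℕ} (h : Lifts M p)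
    (hK : RelDimLE M (kernel p) n) (hA : RelDimLE M A (n + 1)) : RelDimLE M W (n + 1) :=
  (shortExact_map_kernel h).hasProjectiveDimensionLT_X₃ _ hK hA

theorem RelDimLE.kernel {A W : C} {p : A ⟶ W} {n : ℕ} (h : Lifts M p)
    (hW : RelDimLE M W (n + 1)) (hA : RelDimLE M A n) : RelDimLE M (kernel p) n :=
  (shortExact_map_kernel h).hasProjectiveDimensionLT_X₁ _ hA hW

variable (M) in
/-- Morphisms that are surjective on `Hom(M, -)` are epimorphisms. -/
def IsGen : Prop := ∀ {A W : C} (p : A ⟶ W), Lifts M p → Epi p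

theorem IsGen.eq_zero (hM : IsGen M) {A W : C} (f : A ⟶ W) (h : ∀ φ : M ⟶ A, φ ≫ f = 0) :
    f = 0 := by
  have := hM (Limits.kernel.ι f) fun φ ↦ ⟨kernel.lift f φ (h φ), by simp⟩
  exact (cancel_epi (Limits.kernel.ι f)).1 (by simp)

theorem IsGen.map_injective (hM : IsGen M) {A W : C} {f g : A ⟶ W}
    (h : (homFunctor M).map f = (homFunctor M).map g) : f = g := by
  rw [← sub_eq_zero]
  refine hM.eq_zero _ fun φ ↦ ?_
  have : toHom M ((homFunctor M).map f (ofHom M φ)) =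
      toHom M ((homFunctor M).map g (ofHom M φ)) := by
    rw [h]
  simpa [toHom_map, sub_eq_zero] using this

theorem IsGen.isRetractOfSum_of_relDimLE (hM : IsGen M) {T W : C} {p : T ⟶ W}
    (hT : IsRetractOfSum M T) (hp : Lifts M p) (hW : RelDimLE M W 0) : IsRetractOfSum M W := by
  have := hM p hp
  have : Projective ((homFunctor M).obj W) :=
    (projective_iff_hasProjectiveDimensionLE_zero _).2 hW
  let s := (shortExact_map_kernel hp).splittingOfProjective
  obtain ⟨ρ, hρ⟩ := hT.exists_map_eq s.r
  have hρ' : Limits.kernel.ι p ≫ ρ = 𝟙 _ := hM.map_injective (by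
    rw [Functor.map_comp, hρ, CategoryTheory.Functor.map_id]; exact s.f_r)
  refine hT.retract {
    i := Abelian.epiDesc p (𝟙 _ - ρ ≫ Limits.kernel.ι p) ?_
    r := p
    retract := ?_ }
  · simp [reassoc_of% hρ']
  · rw [← cancel_epi p]
    rw [← Category.assoc, Abelian.comp_epiDesc]
    simp [Preadditive.sub_comp]

end HomFunctor

section ModuleCat

variable {Λ : Type u} [Ring Λ]

theorem InAdd.isRetractOfSum {M X : ModuleCat.{u} Λ} (h : InAdd Λ M X) : IsRetractOfSum M X := by
  obtain ⟨r, Y, ⟨e⟩⟩ := h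
  exact ⟨r, ⟨{ i := biprod.inl ≫ e.hom, r := e.inv ≫ biprod.fst }⟩⟩

theorem isGen_of_isRetractOfSum {M : ModuleCat.{u} Λ}
    (h : IsRetractOfSum M (ModuleCat.of Λ Λ)) : IsGen M := fun {A W} p hp ↦ by
  rw [ModuleCat.epi_iff_surjective]
  intro w
  obtain ⟨ψ, hψ⟩ := hp.of_isRetractOfSum h (ModuleCat.ofHom (LinearMap.toSpanSingleton Λ W w))
  refine ⟨ψ (1 : Λ), ?_⟩
  have := congr($hψ (1 : Λ))
  simpa using this

theorem finite_of_epi {A W : ModuleCat.{u} Λ} (p : A ⟶ W) [Epi p] [Module.Finite Λ A] :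
    Module.Finite Λ W :=
  Module.Finite.of_surjective p.hom ((ModuleCat.epi_iff_surjective p).1 inferInstance)

theorem finite_of_mono [IsNoetherianRing Λ] {A W : ModuleCat.{u} Λ} (p : A ⟶ W) [Mono p]
    [Module.Finite Λ W] : Module.Finite Λ A :=
  Module.Finite.of_injective p.hom ((ModuleCat.mono_iff_injective p).1 inferInstance)

theorem finite_biproduct {r : ℕ} (A : Fin r → ModuleCat.{u} Λ) (h : ∀ i, Module.Finite Λ (A i)) :
    Module.Finite Λ (⨁ A : ModuleCat.{u} Λ) :=
  Module.Finite.equiv (ModuleCat.biproductIsoPi A).symm.toLinearEquiv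

instance finite_biprod (A B : ModuleCat.{u} Λ) [Module.Finite Λ A] [Module.Finite Λ B] :
    Module.Finite Λ (A ⊞ B : ModuleCat.{u} Λ) :=
  Module.Finite.equiv (ModuleCat.biprodIsoProd A B).symm.toLinearEquiv

theorem IsRetractOfSum.finite {M T : ModuleCat.{u} Λ} [Module.Finite Λ M]
    (h : IsRetractOfSum M T) : Module.Finite Λ T := by
  obtain ⟨r, ⟨e⟩⟩ := h
  have := finite_biproduct (fun _ : Fin r ↦ M) fun _ ↦ inferInstance
  exact finite_of_epi e.r

instance finite_kernel [IsNoetherianRing Λ] {A W : ModuleCat.{u} Λ} (p : A ⟶ W)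
    [Module.Finite Λ A] : Module.Finite Λ (kernel p : ModuleCat.{u} Λ) :=
  finite_of_mono (kernel.ι p)

open scoped ModuleCat in
theorem isNoetherian_homFunctor (k : Type u) [Field k] [Algebra k Λ] [FiniteDimensional k Λ]
    (M W : ModuleCat.{u} Λ) [Module.Finite Λ M] [Module.Finite Λ W] :
    IsNoetherian (End (op M)) ((homFunctor M).obj W) := by
  obtain ⟨n, s, hs⟩ := Module.Finite.exists_fin (R := Λ) (M := M)
  have : Module.Finite k W := Module.Finite.trans Λ W
  let E : (M ⟶ W) →ₗ[k] (Fin n → W) :=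
    { toFun φ i := φ (s i)
      map_add' _ _ := rfl
      map_smul' _ _ := rfl }
  have hE : Function.Injective E := fun φ ψ h ↦
    ModuleCat.hom_ext (LinearMap.ext_on_range hs fun i ↦ congrFun h i)
  let F (p : Submodule (End (op M)) ((homFunctor M).obj W)) : Submodule k (M ⟶ W) :=
    { carrier := {φ | ofHom M φ ∈ p}
      add_mem' := fun ha hb ↦ p.add_mem ha hb
      zero_mem' := p.zero_mem
      smul_mem' := fun c φ hφ ↦ by
        have := p.smul_mem (c • 𝟙 M : M ⟶ M).op hφ
        rw [smul_ofHom] at this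
        simpa using this }
  have : FiniteDimensional k (M ⟶ W) := Module.Finite.of_injective E hE
  have hF : StrictMono F := by
    refine Monotone.strictMono_of_injective (fun p q hpq φ hφ ↦ hpq hφ) fun p q hpq ↦ ?_
    ext x
    exact SetLike.ext_iff.1 hpq (toHom M x)
  exact isNoetherian_iff'.2 hF.wellFoundedGT

theorem exists_lifts (k : Type u) [Field k] [Algebra k Λ] [FiniteDimensional k Λ]
    (M W : ModuleCat.{u} Λ) [Module.Finite Λ M] [Module.Finite Λ W] :
    ∃ (T : ModuleCat.{u} Λ) (p : T ⟶ W), IsRetractOfSum M T ∧ Lifts M p := by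
  have := isNoetherian_homFunctor k M W
  obtain ⟨n, s, hs⟩ := Module.Finite.exists_fin (R := End (op M)) (M := (homFunctor M).obj W)
  refine ⟨⨁ fun _ : Fin n ↦ M, biproduct.desc fun i ↦ toHom M (s i),
    isRetractOfSum_biproduct M n, fun φ ↦ ?_⟩
  have hφ : ofHom M φ ∈ Submodule.span (End (op M)) (Set.range s) := by simp [hs]
  obtain ⟨c, hc⟩ := (Submodule.mem_span_range_iff_exists_fun _).1 hφ
  refine ⟨∑ i, Quiver.Hom.unop (c i) ≫ biproduct.ι (fun _ : Fin n ↦ M) i, ?_⟩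
  rw [Preadditive.sum_comp]
  simp only [Category.assoc, biproduct.ι_desc]
  have h : ∀ i, ofHom M (Quiver.Hom.unop (c i) ≫ toHom M (s i)) = c i • s i := fun i ↦ rfl
  apply Quiver.Hom.op_inj
  rw [op_sum]
  exact hc

theorem exists_mono_injective (k : Type u) [Field k] [Algebra k Λ] [FiniteDimensional k Λ]
    (W : ModuleCat.{u} Λ) [Module.Finite Λ W] :
    ∃ (I : ModuleCat.{u} Λ) (i : W ⟶ I), Module.Finite Λ I ∧ Injective I ∧ Mono i := by
  let a := algebraMap k Λ
  let adj := ModuleCat.restrictCoextendScalarsAdj.{u} a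
  let V : ModuleCat.{u} k := (ModuleCat.restrictScalars a).obj W
  have : Module.Injective k V := Module.injective_of_isSemisimpleRing k V
  have : Injective V := Module.injective_object_of_injective_module k V
  have hfin (U : ModuleCat.{u} Λ) [Module.Finite Λ U] :
      Module.Finite k ((ModuleCat.restrictScalars a).obj U) := by
    let := Module.compHom U a
    have : IsScalarTower k Λ U := ⟨fun x y z ↦ by
      rw [Algebra.smul_def, mul_smul]; rfl⟩
    exact Module.Finite.trans (R := k) Λ U
  have := hfin W
  have := hfin (ModuleCat.of Λ Λ)
  refine ⟨(ModuleCat.coextendScalars a).obj V, adj.unit.app W, ?_,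
    Injective.injective_of_adjoint adj V, ?_⟩
  · let := Module.compHom ((ModuleCat.coextendScalars a).obj V) a
    have : IsScalarTower k Λ ((ModuleCat.coextendScalars a).obj V) := ⟨fun x y z ↦ by
      rw [Algebra.smul_def, mul_smul]; rfl⟩
    have : Module.Finite k ((ModuleCat.coextendScalars a).obj V) := by
      have : Module.Finite k ((ModuleCat.restrictScalars a).obj (ModuleCat.of Λ Λ) →ₗ[k] V) :=
        inferInstance
      let E : ((ModuleCat.restrictScalars a).obj (ModuleCat.of Λ Λ) →ₗ[k] V) →ₗ[k]
          (ModuleCat.coextendScalars a).obj V :=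
        { toFun := (ModuleCat.CoextendScalars.equiv a V).symm
          map_add' := fun _ _ ↦ rfl
          map_smul' := fun c h ↦ LinearMap.ext fun x : Λ ↦ by
            change c • h x = h (x * algebraMap k Λ c)
            rw [← Algebra.commutes]
            exact (h.map_smul c x).symm }
      exact Module.Finite.of_surjective E (ModuleCat.CoextendScalars.equiv a V).symm.surjective
    exact Module.Finite.of_restrictScalars_finite k Λ _
  · rw [ModuleCat.mono_iff_injective, injective_iff_map_eq_zero]
    intro w hw
    have : (1 : Λ) • w = 0 := congr($hw (1 : Λ))
    simpa using this

end ModuleCat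

theorem hasProjectiveDimensionLE_add_two_iff {D : Type*} [Category D] [Abelian D]
    {A B C Q : D} {i : A ⟶ B} {d : B ⟶ C} {q : C ⟶ Q} [Mono i] [Epi q] {w : i ≫ d = 0}
    {w' : d ≫ q = 0} (h : (ShortComplex.mk i d w).Exact) (h' : (ShortComplex.mk d q w').Exact)
    (hB : Projective B) (hC : Projective C) (r : ℕ) :
    HasProjectiveDimensionLE Q (r + 2) ↔ HasProjectiveDimensionLE A r := by
  have : Epi (kernel.lift q d w') := h'.epi_kernelLift
  have e : i ≫ kernel.lift q d w' = 0 := by rw [← cancel_mono (kernel.ι q)]; simpa using w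
  have hS : (ShortComplex.mk i (kernel.lift q d w') e).ShortExact :=
    { exact := (ShortComplex.exact_iff_of_epi_of_isIso_of_mono
        (S₁ := .mk i (kernel.lift q d w') e) (S₂ := .mk i d w)
        ⟨𝟙 _, 𝟙 _, kernel.ι q, by simp, by simp⟩).2 h }
  exact ((shortExact_kernel q).hasProjectiveDimensionLT_X₃_iff (r + 1) hC).trans
    (hS.hasProjectiveDimensionLT_X₃_iff r hB)

theorem exists_retraction_of_hasProjectiveDimensionLE_one {D : Type*} [Category D] [Abelian D]
    {A B C Q : D} {i : A ⟶ B} {d : B ⟶ C} {q : C ⟶ Q} [Mono i] [Epi q] {w : i ≫ d = 0}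
    {w' : d ≫ q = 0} (h : (ShortComplex.mk i d w).Exact) (h' : (ShortComplex.mk d q w').Exact)
    (hC : Projective C) (hQ : HasProjectiveDimensionLE Q 1) : ∃ r : B ⟶ A, i ≫ r = 𝟙 A := by
  have : Epi (kernel.lift q d w') := h'.epi_kernelLift
  have e : i ≫ kernel.lift q d w' = 0 := by rw [← cancel_mono (kernel.ι q)]; simpa using w
  have hS : (ShortComplex.mk i (kernel.lift q d w') e).ShortExact :=
    { exact := (ShortComplex.exact_iff_of_epi_of_isIso_of_mono
        (S₁ := .mk i (kernel.lift q d w') e) (S₂ := .mk i d w)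
        ⟨𝟙 _, 𝟙 _, kernel.ι q, by simp, by simp⟩).2 h }
  have : Projective (kernel q) := (projective_iff_hasProjectiveDimensionLE_zero _).2
    (((shortExact_kernel q).hasProjectiveDimensionLT_X₃_iff 0 hC).1 hQ)
  exact ⟨hS.splittingOfProjective.r, hS.splittingOfProjective.f_r⟩

section Gldim

variable {Λ : Type u} [Ring Λ]

theorem mono_exact_map {M W A B : ModuleCat.{u} Λ} (i : W ⟶ A) (d : A ⟶ B) [Mono i]
    (w : i ≫ d = 0) (h : (ShortComplex.mk i d w).Exact) :
    Mono ((homFunctor M).map i) ∧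
    (ShortComplex.mk ((homFunctor M).map i) ((homFunctor M).map d)
      (by rw [← Functor.map_comp, w, Functor.map_zero])).Exact := by
  constructor
  · rw [ModuleCat.mono_iff_injective]
    intro x y hxy
    have : toHom M x ≫ i = toHom M y ≫ i := congr(toHom M $hxy)
    exact toHom_injective ((cancel_mono i).1 this)
  · rw [ShortComplex.moduleCat_exact_iff]
    intro x hx
    have hxd : toHom M x ≫ d = 0 := congr(toHom M $hx)
    exact ⟨ofHom M (h.lift (toHom M x) hxd), toHom_injective (h.lift_f (toHom M x) hxd)⟩

/-- `add M` contains the regular module and all finitely generated injective modules. -/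
structure IsFiniteGenCogen (M : ModuleCat.{u} Λ) : Prop where
  finite : Module.Finite Λ M
  gen : IsRetractOfSum M (ModuleCat.of Λ Λ)
  cogen (I : ModuleCat.{u} Λ) : Module.Finite Λ I → Injective I → IsRetractOfSum M I

theorem IsFiniteGenCogen.isGen {M : ModuleCat.{u} Λ} (hM : IsFiniteGenCogen M) : IsGen M :=
  isGen_of_isRetractOfSum hM.gen

theorem IsFiniteGenCogen.exists_mono (k : Type u) [Field k] [Algebra k Λ] [FiniteDimensional k Λ]
    {M : ModuleCat.{u} Λ} (hM : IsFiniteGenCogen M) (W : ModuleCat.{u} Λ)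
    [Module.Finite Λ W] :
    ∃ (I : ModuleCat.{u} Λ) (i : W ⟶ I), IsRetractOfSum M I ∧ Mono i := by
  obtain ⟨I, i, hI, hI', hi⟩ := exists_mono_injective k W
  exact ⟨I, i, hM.cogen I hI hI', hi⟩

theorem IsFiniteGenCogen.relDimLE_of_gldimLE (k : Type u) [Field k] [Algebra k Λ]
    [FiniteDimensional k Λ] {M : ModuleCat.{u} Λ} (hM : IsFiniteGenCogen M) {r : ℕ}
    (h : GldimLE (End (op M)) (r + 2)) (W : ModuleCat.{u} Λ) [Module.Finite Λ W] :
    RelDimLE M W r := by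
  have := hM.finite
  obtain ⟨I, i, hI, hi⟩ := hM.exists_mono k W
  have := hI.finite
  have := finite_of_epi (cokernel.π i)
  obtain ⟨J, j, hJ, hj⟩ := hM.exists_mono k (cokernel i)
  have w : i ≫ cokernel.π i ≫ j = 0 := by simp
  have hex : (ShortComplex.mk i (cokernel.π i ≫ j) w).Exact :=
    (ShortComplex.exact_iff_of_epi_of_isIso_of_mono
      (S₁ := .mk i (cokernel.π i) (cokernel.condition i)) (S₂ := .mk i (cokernel.π i ≫ j) w)
      ⟨𝟙 _, 𝟙 _, j, by simp, by simp⟩).1 (ShortComplex.exact_cokernel i)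
  obtain ⟨h1, h2⟩ := mono_exact_map (M := M) _ _ w hex
  exact (hasProjectiveDimensionLE_add_two_iff h2
    (ShortComplex.exact_cokernel ((homFunctor M).map (cokernel.π i ≫ j)))
    hI.projective hJ.projective r).1 (gldimLE_iff.1 h _)

theorem IsFiniteGenCogen.not_gldimLE_one (k : Type u) [Field k] [Algebra k Λ]
    [FiniteDimensional k Λ] {M : ModuleCat.{u} Λ} (hM : IsFiniteGenCogen M)
    {X Y : ModuleCat.{u} Λ} [Module.Finite Λ Y] (i : X ⟶ Y) [Mono i] (hY : IsRetractOfSum M Y)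
    (hi : ¬ ∃ ρ, i ≫ ρ = 𝟙 X) : ¬ GldimLE (End (op M)) 1 := fun h ↦ by
  have := finite_of_epi (cokernel.π i)
  obtain ⟨J, j, hJ, hj⟩ := hM.exists_mono k (cokernel i)
  have w : i ≫ cokernel.π i ≫ j = 0 := by simp
  have hex : (ShortComplex.mk i (cokernel.π i ≫ j) w).Exact :=
    (ShortComplex.exact_iff_of_epi_of_isIso_of_mono
      (S₁ := .mk i (cokernel.π i) (cokernel.condition i)) (S₂ := .mk i (cokernel.π i ≫ j) w)
      ⟨𝟙 _, 𝟙 _, j, by simp, by simp⟩).1 (ShortComplex.exact_cokernel i)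
  obtain ⟨h1, h2⟩ := mono_exact_map (M := M) _ _ w hex
  obtain ⟨r, hr⟩ := exists_retraction_of_hasProjectiveDimensionLE_one h2
    (ShortComplex.exact_cokernel ((homFunctor M).map (cokernel.π i ≫ j)))
    hJ.projective (gldimLE_iff.1 h _)
  obtain ⟨ρ, rfl⟩ := hY.exists_map_eq r
  exact hi ⟨ρ, IsGen.map_injective hM.isGen (by
    rw [Functor.map_comp, hr, CategoryTheory.Functor.map_id])⟩

theorem IsFiniteGenCogen.gldimLE (k : Type u) [Field k] [Algebra k Λ] [FiniteDimensional k Λ]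
    {M : ModuleCat.{u} Λ} (hM : IsFiniteGenCogen M) {r : ℕ}
    (h : ∀ (W : ModuleCat.{u} Λ) [Module.Finite Λ W], RelDimLE M W r) :
    GldimLE (End (op M)) (r + 2) := by
  have := hM.finite
  have : IsNoetherianRing Λ := IsNoetherianRing.of_finite k Λ
  refine gldimLE_of_quotient fun I ↦ ?_
  have : IsNoetherian (End (op M)) (End (op M)) := isNoetherian_homFunctor k M M
  obtain ⟨n, s, hs⟩ := Submodule.fg_iff_exists_fin_generating_family.1 (IsNoetherian.noetherian I)
  let t : Fin n → (homFunctor M).obj M := s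
  let p : (⨁ fun _ : Fin n ↦ M) ⟶ M := biproduct.desc fun i ↦ toHom M (t i)
  have hT := isRetractOfSum_biproduct M n
  have := hT.finite
  obtain ⟨h1, h2⟩ := mono_exact_map (M := M) _ _ _ (ShortComplex.exact_kernel p)
  have hp (x : (homFunctor M).obj M) : x ∈ I ↔ ∃ y, (homFunctor M).map p y = x := by
    have hι (i : Fin n) : (homFunctor M).map p
        (ofHom M (biproduct.ι (fun _ : Fin n ↦ M) i)) = t i := by
      rw [map_ofHom, biproduct.ι_desc, ofHom_toHom]
    have hmap (c : Fin n → End (op M)) : (homFunctor M).map p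
        (∑ i, c i • ofHom M (biproduct.ι (fun _ : Fin n ↦ M) i)) = ∑ i, c i • t i := by
      rw [map_sum]
      exact Finset.sum_congr rfl fun i _ ↦ (((homFunctor M).map p).hom.map_smul (c i) _).trans
        (congrArg (c i • ·) (hι i))
    rw [← hs]
    refine (Submodule.mem_span_range_iff_exists_fun (End (op M))
      (M := End (op M)) (v := s) (x := x)).trans ⟨?_, ?_⟩
    · rintro ⟨c, rfl⟩
      exact ⟨_, hmap c⟩
    · rintro ⟨y, rfl⟩
      refine ⟨fun i ↦ (toHom M y ≫ biproduct.π (fun _ : Fin n ↦ M) i).op, ?_⟩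
      refine (hmap _).symm.trans (congrArg _ (Quiver.Hom.unop_inj ?_))
      refine (unop_sum _ _ _ _).trans ?_
      change ∑ i, (toHom M y ≫ biproduct.π (fun _ : Fin n ↦ M) i) ≫
        biproduct.ι (fun _ : Fin n ↦ M) i = toHom M y
      simp only [Category.assoc, ← Preadditive.comp_sum, biproduct.total, Category.comp_id]
  let q : (homFunctor M).obj M ⟶ ModuleCat.of (End (op M)) (End (op M) ⧸ I) :=
    ModuleCat.ofHom I.mkQ
  have : Epi q := (ModuleCat.epi_iff_surjective _).2 I.mkQ_surjective
  have w : (homFunctor M).map p ≫ q = 0 := by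
    refine ConcreteCategory.hom_ext _ _ fun y ↦ ?_
    exact (Submodule.Quotient.mk_eq_zero I).2 ((hp _).2 ⟨y, rfl⟩)
  refine (hasProjectiveDimensionLE_add_two_iff (q := q) (w' := w) h2 ?_
    hT.projective projective_homFunctor_self r).2 (h (kernel p))
  rw [ShortComplex.moduleCat_exact_iff]
  intro x hx
  exact (hp x).1 ((Submodule.Quotient.mk_eq_zero I).1 hx)

end Gldim

section AlmostSplit

variable {Λ : Type u} [Ring Λ]

theorem Indec.isCompl {X : ModuleCat.{u} Λ} (hX : Indec Λ X) {p q : Submodule Λ X}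
    (h : IsCompl p q) : p = ⊥ ∨ q = ⊥ := by
  have e := (Submodule.prodEquivOfIsCompl p q h).symm.toModuleIso ≪≫
    (ModuleCat.biprodIsoProd (ModuleCat.of Λ p) (ModuleCat.of Λ q)).symm
  refine (hX.2 _ _ ⟨e⟩).imp (fun h ↦ ?_) (fun h ↦ ?_) <;>
  · have := ModuleCat.subsingleton_of_isZero h
    exact Submodule.eq_bot_of_subsingleton

theorem Indec.isIso_or_isNilpotent {X : ModuleCat.{u} Λ} (hX : Indec Λ X) [IsArtinian Λ X]
    [IsNoetherian Λ X] (v : X ⟶ X) : IsIso v ∨ ∃ n, v.hom ^ n = 0 := by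
  obtain ⟨n, hn⟩ := Filter.eventually_atTop.1 (LinearMap.eventually_isCompl_ker_pow_range_pow v.hom)
  obtain h | h := hX.isCompl (hn (n + 1) n.le_succ)
  · left
    have h1 : Function.Injective v.hom := by
      rw [pow_succ] at h
      rw [← LinearMap.ker_eq_bot, eq_bot_iff, ← h]
      exact LinearMap.ker_le_ker_comp v.hom (v.hom ^ n)
    have h2 := IsArtinian.bijective_of_injective_endomorphism v.hom h1
    exact (ConcreteCategory.isIso_iff_bijective v).2 h2
  · exact .inr ⟨n + 1, LinearMap.range_eq_bot.1 h⟩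

variable {X Y Z : ModuleCat.{u} Λ} {f : X ⟶ Y} {g : Y ⟶ Z}

theorem IsARSeq.shortExact (h : IsARSeq Λ f g) :
    ∃ w, (ShortComplex.mk f g w).ShortExact := by
  obtain ⟨h1, h2, ⟨w, h3⟩, -⟩ := h
  exact ⟨w, { exact := h3 }⟩

theorem IsARSeq.not_retraction (h : IsARSeq Λ f g) : ¬ ∃ ρ, f ≫ ρ = 𝟙 X := by
  rintro ⟨ρ, hρ⟩
  obtain ⟨w, hS⟩ := h.shortExact
  let s := ShortComplex.Splitting.ofExactOfRetraction _ hS.exact ρ hρ hS.epi_g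
  exact h.2.2.2.2.2.1 ⟨s.s, s.s_g⟩

theorem IsARSeq.retract_kernel (h : IsARSeq Λ f g) : Nonempty (Retract (kernel g) X) := by
  obtain ⟨w, hS⟩ := h.shortExact
  have := hS.mono_f
  refine ⟨{
    i := hS.exact.lift (kernel.ι g) (kernel.condition g)
    r := kernel.lift g f w
    retract := ?_ }⟩
  rw [← cancel_mono (kernel.ι g)]
  simp [hS.exact.lift_f (kernel.ι g) (kernel.condition g)]

/-- The left-hand map of an almost split sequence is left almost split. -/
theorem IsARSeq.factors_or_section (h : IsARSeq Λ f g) [IsArtinian Λ X] [IsNoetherian Λ X]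
    {W : ModuleCat.{u} Λ} (a : X ⟶ W) : (∃ b, f ≫ b = a) ∨ ∃ ρ, a ≫ ρ = 𝟙 X := by
  obtain ⟨w, hS⟩ := h.shortExact
  have := hS.mono_f
  have := hS.epi_g
  obtain ⟨-, -, -, hX, -, hg, hlift⟩ := h
  let q : pushout f a ⟶ Z := pushout.desc g 0 (by simp [w])
  have hq : ∀ {V : ModuleCat.{u} Λ} (b : V ⟶ pushout f a), b ≫ q = 0 →
      ∃ c : V ⟶ W, c ≫ pushout.inr f a = b := by
    have hqe : Epi q := epi_of_epi_fac (pushout.inl_desc g 0 (by simp [w]))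
    have e : pushout.inr f a ≫ q = 0 := pushout.inr_desc _ _ _
    have hex : (ShortComplex.mk (pushout.inr f a) q e).Exact := by
      refine ShortComplex.exact_of_g_is_cokernel _ (CokernelCofork.IsColimit.ofπ' q e fun {V} b hb ↦
        ⟨hS.exact.desc (pushout.inl f a ≫ b) ?_, ?_⟩)
      · change f ≫ pushout.inl f a ≫ b = 0
        rw [pushout.condition_assoc, hb, comp_zero]
      · apply pushout.hom_ext
        · rw [pushout.inl_desc_assoc]
          exact hS.exact.g_desc _ _
        · rw [reassoc_of% e, zero_comp]
          exact hb.symm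
    exact fun {V} b hb ↦ ⟨hex.lift b hb, hex.lift_f b hb⟩
  by_cases hsp : ∃ s : Z ⟶ pushout f a, s ≫ q = 𝟙 Z
  · left
    obtain ⟨s, hs⟩ := hsp
    obtain ⟨c, hc⟩ := hq (pushout.inl f a - g ≫ s) (by
      rw [Preadditive.sub_comp, Category.assoc, hs, Category.comp_id, pushout.inl_desc, sub_self])
    refine ⟨c, ?_⟩
    rw [← cancel_mono (pushout.inr f a), Category.assoc, hc, Preadditive.comp_sub,
      reassoc_of% w, zero_comp, sub_zero, pushout.condition]
  · obtain ⟨t, ht⟩ := hlift _ q hsp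
    let y : Y ⟶ Y := pushout.inl f a ≫ t
    have hy : y ≫ g = g := by simp only [y, Category.assoc, ht]; exact pushout.inl_desc _ _ _
    let r : W ⟶ X := hS.exact.lift (pushout.inr f a ≫ t) (by
      change (pushout.inr f a ≫ t) ≫ g = 0
      rw [Category.assoc, ht]; exact pushout.inr_desc _ _ _)
    have hr : r ≫ f = pushout.inr f a ≫ t := hS.exact.lift_f _ _
    have hfy : f ≫ y = (a ≫ r) ≫ f := by
      rw [Category.assoc, hr, pushout.condition_assoc]
    obtain hu | ⟨n, hn⟩ := hX.isIso_or_isNilpotent (a ≫ r)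
    · exact .inr ⟨r ≫ inv (a ≫ r), by rw [← Category.assoc, IsIso.hom_inv_id]⟩
    · exfalso
      have h1 : (y.hom ^ n).comp f.hom = 0 := by
        have := Module.End.commute_pow_left_of_commute (f := f.hom) (g := (a ≫ r).hom)
          (g₂ := y.hom) (congrArg ModuleCat.Hom.hom hfy) n
        exact this.trans (by rw [hn, LinearMap.comp_zero])
      have h2 : g.hom.comp (y.hom ^ n) = g.hom := by
        have := Module.End.commute_pow_left_of_commute (f := g.hom) (g := y.hom)
          (g₂ := (1 : Module.End Λ Z)) (by rw [← ModuleCat.hom_comp, hy]; rfl) n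
        rw [← this, one_pow]; rfl
      have h1' : f ≫ ModuleCat.ofHom (y.hom ^ n) = 0 := ModuleCat.hom_ext h1
      refine hg ⟨hS.exact.desc (ModuleCat.ofHom (y.hom ^ n)) h1', ?_⟩
      rw [← cancel_epi g]
      have h3 : g ≫ hS.exact.desc (ModuleCat.ofHom (y.hom ^ n)) h1' = _ :=
        hS.exact.g_desc _ _
      rw [reassoc_of% h3, Category.comp_id]
      exact ModuleCat.hom_ext h2

end AlmostSplit

section Comparison

variable {Λ : Type u} [Ring Λ]

/-- If `N` has relative dimension at most one over a summand `M` of `N`, then relative dimensions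
for `M` exceed those for `N` by at most one. -/
theorem RelDimLE.of_relDimLE_one (k : Type u) [Field k] [Algebra k Λ] [FiniteDimensional k Λ]
    {M N : ModuleCat.{u} Λ} [Module.Finite Λ N] (hN : IsGen N) (hMN : IsRetractOfSum N M)
    (h : RelDimLE M N 1) (r : ℕ) (W : ModuleCat.{u} Λ) [Module.Finite Λ W]
    (hW : RelDimLE N W r) : RelDimLE M W (r + 1) := by
  have : IsNoetherianRing Λ := IsNoetherianRing.of_finite k Λ
  induction r generalizing W with
  | zero =>
    obtain ⟨T, p, hT, hp⟩ := exists_lifts k N W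
    exact h.of_isRetractOfSum_of (IsGen.isRetractOfSum_of_relDimLE hN hT hp hW)
  | succ r ih =>
    obtain ⟨T, p, hT, hp⟩ := exists_lifts k N W
    have := hT.finite
    exact .of_kernel (hp.of_isRetractOfSum hMN)
      (ih (Limits.kernel p) (hW.kernel hp (.of_isRetractOfSum hT r)))
      ((h.of_isRetractOfSum_of hT).mono (by lia))

variable {X Y Z : ModuleCat.{u} Λ} {f : X ⟶ Y} {g : Y ⟶ Z}

theorem IsARSeq.lifts (h : IsARSeq Λ f g) {T : ModuleCat.{u} Λ} (hT : ¬ IsRetractOfSum T Z) :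
    Lifts T g := fun φ ↦
  h.2.2.2.2.2.2 T φ fun ⟨s, hs⟩ ↦
    hT ((isRetractOfSum_self T).retract { i := s, r := φ, retract := hs })

theorem IsARSeq.relDimLE_one (h : IsARSeq Λ f g) {M : ModuleCat.{u} Λ} (hX : IsRetractOfSum M X)
    (hY : IsRetractOfSum M Y) : RelDimLE M Z 1 := by
  by_cases hZ : IsRetractOfSum M Z
  · exact .of_isRetractOfSum hZ 1
  · obtain ⟨e⟩ := h.retract_kernel
    exact .of_kernel (h.lifts hZ) (.of_isRetractOfSum (hX.retract e) 0) (.of_isRetractOfSum hY 1)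

/-- Enlarging an approximation `p` of `W` along a morphism `h : Z ⟶ W` that does not lift to it. -/
theorem IsARSeq.retract_kernel_desc (hAR : IsARSeq Λ f g) {T W : ModuleCat.{u} Λ} {p : T ⟶ W}
    {h : Z ⟶ W} (hY : Lifts Y p) (hh : ¬ ∃ ψ, ψ ≫ p = h) :
    Nonempty (Retract (kernel (biprod.desc p h)) (Y ⊞ kernel p)) := by
  let ι := kernel.ι (biprod.desc p h)
  have hι : (ι ≫ biprod.fst) ≫ p + (ι ≫ biprod.snd) ≫ h = 0 := by
    rw [Category.assoc, Category.assoc, ← Preadditive.comp_add, ← biprod.desc_eq]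
    exact kernel.condition _
  obtain ⟨t, ht⟩ := hAR.2.2.2.2.2.2 _ (ι ≫ biprod.snd) fun ⟨s, hs⟩ ↦ hh ⟨-(s ≫ ι ≫ biprod.fst), by
    have := congr(s ≫ $hι)
    rw [Preadditive.comp_add, comp_zero, ← Category.assoc s (ι ≫ biprod.snd), hs,
      Category.id_comp] at this
    rw [Preadditive.neg_comp, Category.assoc, eq_comm]
    exact eq_neg_of_add_eq_zero_right this⟩
  obtain ⟨y, hy⟩ := hY (g ≫ h)
  let s : Y ⟶ kernel (biprod.desc p h) := kernel.lift _ (biprod.lift (-y) g) (by simp [hy])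
  have hs : s ≫ ι = biprod.lift (-y) g := kernel.lift_ι _ _ _
  let i : kernel p ⟶ kernel (biprod.desc p h) := kernel.lift _ (kernel.ι p ≫ biprod.inl) (by simp)
  have hi : i ≫ ι = kernel.ι p ≫ biprod.inl := kernel.lift_ι _ _ _
  have hsnd : ((𝟙 _ - t ≫ s) ≫ ι) ≫ biprod.snd = 0 := by
    rw [Preadditive.sub_comp, Preadditive.sub_comp, Category.assoc t, hs, Category.id_comp,
      Category.assoc t, biprod.lift_snd, ht, sub_self]
  let e : kernel (biprod.desc p h) ⟶ kernel p :=
    kernel.lift p (((𝟙 _ - t ≫ s) ≫ ι) ≫ biprod.fst) (by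
      have := congr((𝟙 _ - t ≫ s) ≫ $hι)
      rw [Preadditive.comp_add, comp_zero, ← Category.assoc, ← Category.assoc, ← Category.assoc,
        ← Category.assoc, hsnd, zero_comp, add_zero] at this
      exact this)
  have he : e ≫ i = 𝟙 _ - t ≫ s := by
    rw [← cancel_mono ι, Category.assoc, hi, kernel.lift_ι_assoc]
    apply biprod.hom_ext
    · simp
    · rw [hsnd]
      simp
  exact ⟨{
    i := biprod.lift t e
    r := biprod.desc s i
    retract := by rw [biprod.lift_desc, he]; exact add_sub_cancel _ _ }⟩

theorem IsARSeq.relDimLE_of_left (k : Type u) [Field k] [Algebra k Λ] [FiniteDimensional k Λ]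
    (hAR : IsARSeq Λ f g) {M N : ModuleCat.{u} Λ} [Module.Finite Λ M]
    [Module.Finite Λ N] (hM : IsGen M) (hMN : IsRetractOfSum N M) (hZN : IsRetractOfSum N Z)
    (hN : ∀ {A W : ModuleCat.{u} Λ} (p : A ⟶ W), Lifts M p → Lifts Z p → Lifts N p)
    (hY : IsRetractOfSum M Y) (m : ℕ) (W : ModuleCat.{u} Λ) [Module.Finite Λ W]
    (hW : RelDimLE M W m) : RelDimLE N W m := by
  have : IsNoetherianRing Λ := IsNoetherianRing.of_finite k Λ
  induction m generalizing W with
  | zero =>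
    obtain ⟨T, p, hT, hp⟩ := exists_lifts k M W
    exact .of_isRetractOfSum ((IsGen.isRetractOfSum_of_relDimLE hM hT hp hW).trans hMN) 0
  | succ m ih =>
    obtain ⟨T₀, p₀, hT₀, hp₀⟩ := exists_lifts k M W
    have := isNoetherian_homFunctor k N W
    let S : Set (Submodule (End (op N)) ((homFunctor N).obj W)) :=
      {V | ∃ (T : ModuleCat.{u} Λ) (p : T ⟶ W), IsRetractOfSum N T ∧ Lifts M p ∧
        RelDimLE M (kernel p) m ∧ V = LinearMap.range ((homFunctor N).map p).hom}
    obtain ⟨V, ⟨T, p, hT, hp, hK, rfl⟩, hmax⟩ :=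
      set_has_maximal_iff_noetherian.2 this S ⟨_, T₀, p₀, hT₀.trans hMN, hp₀,
        hW.kernel hp₀ (.of_isRetractOfSum hT₀ m), rfl⟩
    have hpZ : Lifts Z p := fun h ↦ by
      by_contra hh
      obtain ⟨e⟩ := hAR.retract_kernel_desc (hp.of_isRetractOfSum hY) hh
      refine hmax _ ⟨T ⊞ Z, biprod.desc p h, hT.biprod hZN, fun φ ↦ ?_,
        ((RelDimLE.of_isRetractOfSum hY m).biprod hK).retract e, rfl⟩
        (lt_of_le_not_ge ?_ fun hle ↦ hh ?_)
      · obtain ⟨ψ, hψ⟩ := hp φ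
        exact ⟨ψ ≫ biprod.inl, by simp [hψ]⟩
      · rintro _ ⟨x, rfl⟩
        exact ⟨(homFunctor N).map biprod.inl x, toHom_injective (by simp [toHom_map])⟩
      · obtain ⟨r, a, b, hab⟩ := hZN.exists_sum
        have key : ∀ i, ∃ ψ, ψ ≫ p = b i ≫ h := fun i ↦ by
          obtain ⟨x, hx⟩ := hle ⟨ofHom N (b i ≫ biprod.inr), rfl⟩
          exact ⟨toHom N x, by simpa [toHom_map] using congr(toHom N $hx)⟩
        choose ψ hψ using key
        refine ⟨∑ i, a i ≫ ψ i, ?_⟩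
        rw [Preadditive.sum_comp, ← Category.id_comp h, ← hab, Preadditive.sum_comp]
        simp [hψ]
    have hTf := hT.finite
    exact .of_kernel (hN p hp hpZ) (ih (kernel p) hK) (.of_isRetractOfSum hT _)

theorem IsARSeq.exists_factor_kernel (hAR : IsARSeq Λ f g) [IsArtinian Λ X] [IsNoetherian Λ X]
    {T W : ModuleCat.{u} Λ} {p : T ⟶ W} (hX : ¬ IsRetractOfSum T X) (hZ : Lifts Z p)
    (h : X ⟶ kernel p) : ∃ d, f ≫ d = h := by
  obtain ⟨w, hS⟩ := hAR.shortExact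
  have := hS.epi_g
  obtain ⟨y, hy⟩ | ⟨ρ, hρ⟩ := hAR.factors_or_section (h ≫ kernel.ι p)
  · obtain ⟨z, hz⟩ := hZ (hS.exact.desc (y ≫ p) (by
      change f ≫ y ≫ p = 0
      rw [reassoc_of% hy, kernel.condition, comp_zero]))
    have hyz : g ≫ z ≫ p = y ≫ p := by rw [hz]; exact hS.exact.g_desc _ _
    refine ⟨kernel.lift p (y - g ≫ z) (by simp [hyz]), ?_⟩
    rw [← cancel_mono (kernel.ι p), Category.assoc, kernel.lift_ι, Preadditive.comp_sub,
      reassoc_of% w, zero_comp, sub_zero, hy]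
  · exact (hX ((isRetractOfSum_self T).retract { i := _, r := ρ, retract := hρ })).elim

theorem IsARSeq.relDimLE_of_factors (k : Type u) [Field k] [Algebra k Λ] [FiniteDimensional k Λ]
    (hAR : IsARSeq Λ f g) [IsArtinian Λ X] [IsNoetherian Λ X] {M N : ModuleCat.{u} Λ}
    [Module.Finite Λ M] (hN : IsGen N) (hMN : IsRetractOfSum N M)
    (hlift : ∀ {A W : ModuleCat.{u} Λ} (p : A ⟶ W), Lifts M p → Lifts X p → Lifts N p)
    (hX : ¬ IsRetractOfSum M X) (hY : IsRetractOfSum M Y) (hZ : IsRetractOfSum M Z) (r : ℕ)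
    (W : ModuleCat.{u} Λ) [Module.Finite Λ W] (hf : ∀ h : X ⟶ W, ∃ d, f ≫ d = h)
    (hW : RelDimLE N W r) : RelDimLE M W r := by
  have : IsNoetherianRing Λ := IsNoetherianRing.of_finite k Λ
  induction r generalizing W with
  | zero =>
    obtain ⟨T, p, hT, hp⟩ := exists_lifts k M W
    have hpN : Lifts N p := hlift p hp fun h ↦ by
      obtain ⟨d, rfl⟩ := hf h
      obtain ⟨e, rfl⟩ := hp.of_isRetractOfSum hY d
      exact ⟨f ≫ e, Category.assoc _ _ _⟩
    obtain ⟨s, hs⟩ := hpN.of_isRetractOfSum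
      (IsGen.isRetractOfSum_of_relDimLE hN (hT.trans hMN) hpN hW) (𝟙 W)
    exact .of_isRetractOfSum (hT.retract { i := s, r := p, retract := hs }) 0
  | succ r ih =>
    obtain ⟨T, p, hT, hp⟩ := exists_lifts k M W
    have := hT.finite
    have hpN : Lifts N p := hlift p hp fun h ↦ by
      obtain ⟨d, rfl⟩ := hf h
      obtain ⟨e, rfl⟩ := hp.of_isRetractOfSum hY d
      exact ⟨f ≫ e, Category.assoc _ _ _⟩
    exact .of_kernel hp (ih (kernel p)
      (hAR.exists_factor_kernel (fun h ↦ hX (h.trans hT)) (hp.of_isRetractOfSum hZ))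
      (hW.kernel hpN (.of_isRetractOfSum (hT.trans hMN) r))) (.of_isRetractOfSum hT _)

theorem exists_kernel_retract_biprod {C : Type*} [Category C] [Abelian C] {X W : C} {h : X ⟶ W}
    {ρ : W ⟶ X} (hρ : h ≫ ρ = 𝟙 X) :
    Nonempty (Retract (kernel ρ) W) ∧ Nonempty (Retract W (X ⊞ kernel ρ)) := by
  let r : W ⟶ kernel ρ := kernel.lift ρ (𝟙 W - ρ ≫ h) (by simp [hρ])
  have hr : r ≫ kernel.ι ρ = 𝟙 W - ρ ≫ h := kernel.lift_ι _ _ _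
  refine ⟨⟨{ i := kernel.ι ρ, r := r, retract := ?_ }⟩,
    ⟨{ i := biprod.lift ρ r, r := biprod.desc h (kernel.ι ρ), retract := by simp [hr] }⟩⟩
  rw [← cancel_mono (kernel.ι ρ), Category.assoc, hr]
  simp

theorem IsARSeq.relDimLE_of_right (k : Type u) [Field k] [Algebra k Λ] [FiniteDimensional k Λ]
    (hAR : IsARSeq Λ f g) [IsArtinian Λ X] [IsNoetherian Λ X] {M N : ModuleCat.{u} Λ}
    [Module.Finite Λ M] (hM : IsGen M) (hMN : IsRetractOfSum N M) (hXN : IsRetractOfSum N X)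
    (hlift : ∀ {A W : ModuleCat.{u} Λ} (p : A ⟶ W), Lifts M p → Lifts X p → Lifts N p)
    (hY : IsRetractOfSum M Y) (m : ℕ) (W : ModuleCat.{u} Λ) [Module.Finite Λ W]
    (hW : RelDimLE M W m) : RelDimLE N W m := by
  have : IsNoetherianRing Λ := IsNoetherianRing.of_finite k Λ
  have : IsArtinianRing Λ := IsArtinianRing.of_finite k Λ
  induction m generalizing W with
  | zero =>
    obtain ⟨T, p, hT, hp⟩ := exists_lifts k M W
    exact .of_isRetractOfSum ((IsGen.isRetractOfSum_of_relDimLE hM hT hp hW).trans hMN) 0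
  | succ m ihm =>
    induction hl : Module.length Λ W using WellFoundedLT.induction generalizing W with
    | ind l ih =>
    by_cases hf : ∀ h : X ⟶ W, ∃ d, f ≫ d = h
    · obtain ⟨T, p, hT, hp⟩ := exists_lifts k M W
      have := hT.finite
      have hpN : Lifts N p := hlift p hp fun h ↦ by
        obtain ⟨d, rfl⟩ := hf h
        obtain ⟨e, rfl⟩ := hp.of_isRetractOfSum hY d
        exact ⟨f ≫ e, Category.assoc _ _ _⟩
      exact .of_kernel hpN (ihm (kernel p) (hW.kernel hp (.of_isRetractOfSum hT m)))
        (.of_isRetractOfSum (hT.trans hMN) _)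
    · push Not at hf
      obtain ⟨h, hh⟩ := hf
      obtain ⟨d, hd⟩ | ⟨ρ, hρ⟩ := hAR.factors_or_section h
      · exact (hh d hd).elim
      · obtain ⟨⟨e⟩, ⟨e'⟩⟩ := exists_kernel_retract_biprod hρ
        refine ((RelDimLE.of_isRetractOfSum hXN _).biprod
          (ih _ ?_ (kernel ρ) (hW.retract e) rfl)).retract e'
        rw [(ModuleCat.kernelIsoKer ρ).toLinearEquiv.length_eq, ← hl]
        refine Submodule.length_lt fun htop ↦ hAR.2.2.2.1.1 ?_
        have hρ0 : ρ = 0 := ModuleCat.hom_ext (LinearMap.ker_eq_top.1 htop)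
        rw [IsZero.iff_id_eq_zero, ← hρ, hρ0, comp_zero]

theorem gldim_comparison {A B : Type u} [Ring A] [Ring B]
    (h : ∀ r, GldimLE A r → GldimLE B r) (h' : ∀ r, GldimLE B r → GldimLE A (r + 1)) :
    gldim B ≤ gldim A ∧ gldim A ≤ gldim B + 1 ∧ ((∃ r, GldimLE A r) ↔ ∃ r, GldimLE B r) := by
  refine ⟨?_, ?_, fun ⟨r, hr⟩ ↦ ⟨r, h r hr⟩, fun ⟨r, hr⟩ ↦ ⟨r + 1, h' r hr⟩⟩
  · refine le_sInf ?_
    rintro _ ⟨r, rfl, hr⟩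
    exact sInf_le ⟨r, rfl, h r hr⟩
  · by_cases hB : ∃ r, GldimLE B r
    · obtain ⟨r, hr, hr'⟩ : gldim B ∈ {c : ℕ∞ | ∃ r : ℕ, c = (r : ℕ∞) ∧ GldimLE B r} :=
        csInf_mem (hB.imp' _ fun r hr ↦ ⟨r, rfl, hr⟩)
      rw [hr]
      exact sInf_le ⟨r + 1, by simp, h' r hr'⟩
    · have : gldim B = ⊤ := sInf_eq_top.2 fun _ ⟨r, _, hr⟩ ↦ (hB ⟨r, hr⟩).elim
      simp [this]

theorem GldimLE.mono {A : Type u} [Ring A] {r s : ℕ} (h : GldimLE A r) (hrs : r ≤ s) :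
    GldimLE A s := fun N ↦ by
  obtain ⟨P, d, f, hP, hz, hd⟩ := h N
  exact ⟨P, d, f, hP, fun i hi ↦ hz i (hrs.trans_lt hi), hd⟩

/-- Comparison of the global dimensions of endomorphism rings by relative dimensions. -/
theorem IsFiniteGenCogen.gldimLE_of_gldimLE (k : Type u) [Field k] [Algebra k Λ]
    [FiniteDimensional k Λ] (hAR : IsARSeq Λ f g) [Module.Finite Λ Y] {M N : ModuleCat.{u} Λ}
    (hM : IsFiniteGenCogen M) (hN : IsFiniteGenCogen N) (hY : IsRetractOfSum M Y) {s : ℕ}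
    (h : ∀ (r : ℕ), (∀ (W : ModuleCat.{u} Λ) [Module.Finite Λ W], RelDimLE M W r) →
      ∀ (W : ModuleCat.{u} Λ) [Module.Finite Λ W], RelDimLE N W (r + s)) (r : ℕ)
    (hr : GldimLE (End (op M)) r) : GldimLE (End (op N)) (r + s) := by
  obtain ⟨w, hS⟩ := hAR.shortExact
  have : Mono f := hS.mono_f
  obtain hr' | ⟨r, rfl⟩ : r ≤ 1 ∨ ∃ q, r = q + 2 := by
    obtain h | h := Nat.lt_or_ge 1 r
    · exact .inr ⟨r - 2, by lia⟩
    · exact .inl h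
  · exact (hM.not_gldimLE_one k f hY hAR.not_retraction (hr.mono hr')).elim
  · rw [add_right_comm]
    exact hN.gldimLE k (h r fun W _ ↦ hM.relDimLE_of_gldimLE k hr W)

end Comparison

/-- Theorem `theo-gldimARseq`: for an Auslander-Reiten sequence
`0 → X → Y → Z → 0` and a generator-cogenerator `M` with `Y ∈ add M`, setting
`N = M ⊕ X ⊕ Z`, if `X ∈ add M` or `Z ∈ add M` then
`0 ≤ gldim End_Λ(M) - gldim End_Λ(N) ≤ 1`; in particular `End_Λ(M)` has finite global
dimension iff so does `End_Λ(N)`. -/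
theorem statement3 (k : Type u) [Field k] (Λ : Type u) [Ring Λ] [Algebra k Λ]
    [FiniteDimensional k Λ]
    (X Y Z : ModuleCat.{u} Λ)
    (hXfin : Module.Finite Λ X) (hYfin : Module.Finite Λ Y) (hZfin : Module.Finite Λ Z)
    (f : X ⟶ Y) (g : Y ⟶ Z) (hAR : IsARSeq Λ f g)
    (M : ModuleCat.{u} Λ) (hMfin : Module.Finite Λ M) (hgc : IsGenCogen Λ M)
    (hY : InAdd Λ M Y)
    (N : ModuleCat.{u} Λ) (hN : N = (M ⊞ X ⊞ Z))
    (hXZ : InAdd Λ M X ∨ InAdd Λ M Z) :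
    gldim (End (op N)) ≤ gldim (End (op M)) ∧
    gldim (End (op M)) ≤ gldim (End (op N)) + 1 ∧
    ((∃ r : ℕ, GldimLE (End (op M)) r) ↔ (∃ r : ℕ, GldimLE (End (op N)) r)) := by
  subst hN
  let N := M ⊞ X ⊞ Z
  have : IsNoetherianRing Λ := IsNoetherianRing.of_finite k Λ
  have : IsArtinianRing Λ := IsArtinianRing.of_finite k Λ
  have hMN : IsRetractOfSum N M := (isRetractOfSum_self N).retract
    { i := biprod.inl, r := biprod.fst }
  have hXN : IsRetractOfSum N X := (isRetractOfSum_self N).retract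
    { i := biprod.inl ≫ biprod.inr, r := biprod.snd ≫ biprod.fst }
  have hZN : IsRetractOfSum N Z := (isRetractOfSum_self N).retract
    { i := biprod.inr ≫ biprod.inr, r := biprod.snd ≫ biprod.snd }
  have hlift {A W : ModuleCat.{u} Λ} (p : A ⟶ W) (hM : Lifts M p) (hX : Lifts X p)
      (hZ : Lifts Z p) : Lifts N p := hM.biprod (hX.biprod hZ)
  have hM : IsFiniteGenCogen M :=
    ⟨hMfin, hgc.1.isRetractOfSum, fun I hI hI' ↦ (hgc.2 I hI hI').isRetractOfSum⟩
  have hN : IsFiniteGenCogen N :=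
    ⟨inferInstanceAs (Module.Finite Λ (M ⊞ X ⊞ Z : ModuleCat.{u} Λ)), hM.gen.trans hMN,
      fun I hI hI' ↦ (hM.cogen I hI hI').trans hMN⟩
  have := hN.finite
  have hY := hY.isRetractOfSum
  apply gldim_comparison
  · refine hM.gldimLE_of_gldimLE k hAR hN hY (s := 0) fun r h W _ ↦ ?_
    by_cases hX : IsRetractOfSum M X
    · exact hAR.relDimLE_of_left k hM.isGen hMN hZN
        (fun p hp hZ ↦ hlift p hp (hp.of_isRetractOfSum hX) hZ) hY r W (h W)
    · have hZ := (hXZ.resolve_left fun h ↦ hX h.isRetractOfSum).isRetractOfSum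
      exact hAR.relDimLE_of_right k hM.isGen hMN hXN
        (fun p hp hX ↦ hlift p hp hX (hp.of_isRetractOfSum hZ)) hY r W (h W)
  · refine hN.gldimLE_of_gldimLE k hAR hM (hY.trans hMN) (s := 1) fun r h W _ ↦ ?_
    by_cases hX : IsRetractOfSum M X
    · exact .of_relDimLE_one k hN.isGen hMN
        ((RelDimLE.of_isRetractOfSum (isRetractOfSum_self M) 1).biprod
        ((RelDimLE.of_isRetractOfSum hX 1).biprod (hAR.relDimLE_one hX hY))) r W (h W)
    · have hZ := (hXZ.resolve_left fun h ↦ hX h.isRetractOfSum).isRetractOfSum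
      obtain ⟨T, p, hT, hp⟩ := exists_lifts k M W
      have := hT.finite
      exact .of_kernel hp (hAR.relDimLE_of_factors k hN.isGen hMN
        (fun p hp hX ↦ hlift p hp hX (hp.of_isRetractOfSum hZ)) hX hY hZ r (kernel p)
        (hAR.exists_factor_kernel (fun h ↦ hX (h.trans hT)) (hp.of_isRetractOfSum hZ))
        (h _)) (.of_isRetractOfSum hT _)

end Rigidity
end
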